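/- Let G be a finite group that is minimally faithful of degree 3. Then G is not perfect, i.e., the commutator subgroup [G,G] is a proper subgroup of G. -/

import Mathlib

/-- `rdim G` is the smallest `n` such that `G` has a faithful `n`-dimensional
complex representation, i.e. an injective group homomorphism `G →* GL n ℂ`. -/
noncomputable def rdim (G : Type*) [Group G] : ℕ :=
  sInf {n : ℕ | ∃ ρ : G →* GL (Fin n) ℂ, Function.Injective ρ}

/-- `G` is minimally faithful of degree `n` if `rdim G = n` and every proper
subgroup has strictly smaller representation dimension. -/
def MinFaithful (G : Type*) [Group G] (n : ℕ) : Prop :=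
  rdim G = n ∧ ∀ H : Subgroup G, H ≠ ⊤ → rdim H < n

section A1

open Matrix in
lemma diag_basis {G : Type*} [Group G] [Finite G] {n : ℕ} (ρ : G →* GL (Fin n) ℂ)
    (A : Subgroup G) (hA : ∀ a ∈ A, ∀ b ∈ A, a * b = b * a) :
    ∃ v : Module.Basis (Fin n) ℂ (Fin n → ℂ), ∃ l : Fin n → G → ℂ,
      ∀ a ∈ A, ∀ i, (ρ a : Matrix (Fin n) (Fin n) ℂ) *ᵥ v i = l i a • v i := by
  classical
  let f : A → Module.End ℂ (Fin n → ℂ) := fun a => Matrix.toLin' (ρ a : Matrix (Fin n) (Fin n) ℂ)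
  have hcomm : ∀ a b, Commute (f a) (f b) := by
    intro a b
    have : (a : G) * b = b * a := hA a a.2 b b.2
    have h2 : (ρ a : Matrix (Fin n) (Fin n) ℂ) * ρ b = ρ b * ρ a := by
      rw [← Units.val_mul, ← map_mul, this, map_mul, Units.val_mul]
    simp only [f, Commute, SemiconjBy, Module.End.mul_eq_comp, ← Matrix.toLin'_mul, h2]
  have hss : ∀ a, (f a).IsSemisimple := by
    intro a
    apply Module.End.isSemisimple_of_squarefree_aeval_eq_zero (p := (Polynomial.X ^ (Nat.card G) - Polynomial.C (1:ℂ)))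
    · apply Polynomial.Separable.squarefree
      apply Polynomial.separable_X_pow_sub_C _ _ one_ne_zero
      exact_mod_cast Nat.card_pos.ne'
    · have : (ρ a : Matrix (Fin n) (Fin n) ℂ) ^ Nat.card G = 1 := by
        rw [← Units.val_pow_eq_pow_val, ← map_pow, pow_card_eq_one', map_one, Units.val_one]
      simp only [map_sub, map_pow, Polynomial.aeval_X, Polynomial.aeval_C, map_one, f]
      rw [← Matrix.toLin'_pow, this, Matrix.toLin'_one, sub_eq_zero]; rfl
  have htop := Module.End.iSup_iInf_maxGenEigenspace_eq_top_of_iSup_maxGenEigenspace_eq_top_of_commute f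
    (fun a b _ => hcomm a b) (fun a => Module.End.iSup_maxGenEigenspace_eq_top (f a))
  have hind := Module.End.independent_iInf_maxGenEigenspace_of_forall_mapsTo f
    (fun a b φ => Module.End.mapsTo_maxGenEigenspace_of_comm (hcomm b a) φ)
  have hintl := DirectSum.isInternal_submodule_of_iSupIndep_of_iSup_eq_top hind htop
  let b := hintl.collectedBasis (fun χ => Module.finBasis ℂ _)
  have hcard : Nat.card (Σ χ : A → ℂ, Fin (Module.finrank ℂ
     (⨅ i, (f i).maxGenEigenspace (χ i) : Submodule ℂ (Fin n → ℂ)))) = n := by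
    rw [← Module.finrank_eq_nat_card_basis b]; simp
  have hfin : Finite (Σ χ : A → ℂ, Fin (Module.finrank ℂ
     (⨅ i, (f i).maxGenEigenspace (χ i) : Submodule ℂ (Fin n → ℂ)))) := Module.Finite.finite_basis b
  let e := (Finite.equivFinOfCardEq hcard)
  refine ⟨b.reindex e, fun i a => if h : a ∈ A then (e.symm i).1 ⟨a, h⟩ else 0, ?_⟩
  intro a ha i
  have hm := hintl.collectedBasis_mem (fun χ => Module.finBasis ℂ _) (e.symm i)
  rw [Submodule.mem_iInf] at hm
  have := hm ⟨a, ha⟩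
  rw [(hss ⟨a, ha⟩).isFinitelySemisimple.maxGenEigenspace_eq_eigenspace, Module.End.mem_eigenspace_iff] at this
  simp only [ha, dif_pos, Module.Basis.reindex_apply]
  exact this

open Matrix in
lemma diag_rep {G : Type*} [Group G] [Finite G] {n : ℕ} (ρ : G →* GL (Fin n) ℂ)
    (hρ : Function.Injective ρ)
    (A : Subgroup G) (hA : ∀ a ∈ A, ∀ b ∈ A, a * b = b * a) :
    ∃ ρ' : G →* GL (Fin n) ℂ, Function.Injective ρ' ∧
      (∀ g, (ρ' g : Matrix (Fin n) (Fin n) ℂ).trace = (ρ g : Matrix (Fin n) (Fin n) ℂ).trace) ∧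
      (∀ g, (ρ' g : Matrix (Fin n) (Fin n) ℂ).det = (ρ g : Matrix (Fin n) (Fin n) ℂ).det) ∧
      ∃ l : Fin n → G → ℂ, ∀ a ∈ A, (ρ' a : Matrix (Fin n) (Fin n) ℂ) = diagonal (fun i => l i a) := by
  obtain ⟨v, l, h⟩ := diag_basis ρ A hA
  let Q : Matrix (Fin n) (Fin n) ℂ := (Matrix.of (fun i j => v j i))
  have hQ : IsUnit Q := by
    rw [← Matrix.linearIndependent_cols_iff_isUnit]
    exact v.linearIndependent
  obtain ⟨q, hq⟩ := hQ
  refine ⟨(MulAut.conj q⁻¹).toMonoidHom.comp ρ, ?_, ?_, ?_, l, ?_⟩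
  · exact (MulAut.conj q⁻¹).injective.comp hρ
  · intro g
    simp [Matrix.trace_mul_comm _ (q : Matrix (Fin n) (Fin n) ℂ), ← mul_assoc]
  · intro g
    have := Matrix.det_units_conj' q (ρ g : Matrix (Fin n) (Fin n) ℂ)
    simpa using this
  · intro a ha
    have h1 : (ρ a : Matrix (Fin n) (Fin n) ℂ) * q = q * diagonal (fun i => l i a) := by
      rw [hq]
      ext i j
      have := congrFun (h a ha j) i
      rw [Matrix.mul_diagonal]
      simp only [Matrix.mul_apply, Matrix.mulVec, dotProduct, Q, Matrix.of_apply] at this ⊢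
      rw [this]; simp [mul_comm]
    have : ((MulAut.conj q⁻¹).toMonoidHom.comp ρ a : GL (Fin n) ℂ) = q⁻¹ * (ρ a * q) := by
      simp [mul_assoc]
    rw [this, Units.val_mul, Units.val_mul, h1, ← mul_assoc]; simp

/-- weights of an abelian subgroup and the permutation action of the normalizer -/
lemma weights {G : Type*} [Group G] [Finite G] {n : ℕ} (ρ : G →* GL (Fin n) ℂ)
    (hρ : Function.Injective ρ)
    (A : Subgroup G) (hA : ∀ a ∈ A, ∀ b ∈ A, a * b = b * a) :
    ∃ l : Fin n → A →* ℂ,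
      (∀ a b : A, (∀ i, l i a = l i b) → a = b) ∧
      (∀ a : A, (ρ a : Matrix (Fin n) (Fin n) ℂ).trace = ∑ i, l i a) ∧
      (∀ a : A, (ρ a : Matrix (Fin n) (Fin n) ℂ).det = ∏ i, l i a) ∧
      (∀ g : G, ∀ φ : A → A, (∀ a : A, g * a = φ a * g) →
        ∃ π : Equiv.Perm (Fin n), ∀ i a, l i (φ a) = l (π i) a) := by
  classical
  obtain ⟨ρ', h1, h2, h3, l, hl⟩ := diag_rep ρ hρ A hA
  refine ⟨fun i => ⟨⟨fun a => l i a, ?_⟩, ?_⟩, ?_, ?_, ?_, ?_⟩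
  · have := congrFun (congrFun (hl 1 A.one_mem) i) i
    simpa using this.symm
  · intro a b
    have := congrFun (congrFun (hl (a * b) (A.mul_mem a.2 b.2)) i) i
    rw [map_mul, Units.val_mul, hl a a.2, hl b b.2] at this
    simpa using this.symm
  · intro a b hab
    apply Subtype.ext
    apply h1
    apply Units.ext
    rw [hl a a.2, hl b b.2]
    congr 1
    ext i; exact hab i
  · intro a
    rw [← h2, hl a a.2, Matrix.trace_diagonal]; rfl
  · intro a
    rw [← h3, hl a a.2, Matrix.det_diagonal]; rfl
  · intro g φ hφ
    have hdet : (ρ' g : Matrix (Fin n) (Fin n) ℂ).det ≠ 0 := by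
      have := (ρ' g).isUnit
      rw [Matrix.isUnit_iff_isUnit_det] at this
      exact this.ne_zero
    rw [← Matrix.det_transpose, Matrix.det_apply] at hdet
    obtain ⟨π, -, hπ⟩ := Finset.exists_ne_zero_of_sum_ne_zero hdet
    refine ⟨π, fun i a => ?_⟩
    have hne : (ρ' g : Matrix (Fin n) (Fin n) ℂ) i (π i) ≠ 0 := by
      intro h0
      apply hπ
      have : ∏ j, (ρ' g : Matrix (Fin n) (Fin n) ℂ).transpose (π j) j = 0 :=
        Finset.prod_eq_zero (Finset.mem_univ i) h0
      rw [this, smul_zero]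
    have h5 := congrArg (fun x => (ρ' x : Matrix (Fin n) (Fin n) ℂ) i (π i)) (hφ a)
    simp only [map_mul, Units.val_mul, hl a a.2, hl (φ a) (φ a).2, Matrix.mul_diagonal, Matrix.diagonal_mul] at h5
    rw [mul_comm] at h5
    exact (mul_right_cancel₀ hne h5).symm

end A1

section A2

/-- The situation of a hypothetical perfect counterexample. -/
structure PCtx (G : Type*) [Group G] [Finite G] (ρ : G →* GL (Fin 3) ℂ) : Prop where
  inj : Function.Injective ρ
  perf : commutator G = ⊤
  small : ∀ H : Subgroup G, H ≠ ⊤ → ∃ n ≤ 2, ∃ f : H →* GL (Fin n) ℂ, Function.Injective f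
  nosmall : ∀ n ≤ 2, ∀ f : G →* GL (Fin n) ℂ, ¬ Function.Injective f

lemma perf_hom {G : Type*} [Group G] (hp : commutator G = ⊤) {A : Type*} [CommGroup A]
    (f : G →* A) (g : G) : f g = 1 := by
  have h1 : commutator G ≤ f.ker := Abelianization.commutator_subset_ker f
  rw [hp] at h1
  exact h1 (Subgroup.mem_top g)

lemma perf_abelian {G : Type*} [Group G] (hp : commutator G = ⊤)
    (hc : ∀ a b : G, a * b = b * a) (g : G) : g = 1 := by
  have h1 : commutator G ≤ ⊥ := by
    rw [commutator_def, Subgroup.commutator_le]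
    intro a _ b _
    rw [Subgroup.mem_bot, commutatorElement_eq_one_iff_mul_comm]
    exact hc a b
  rw [hp] at h1
  exact h1 (Subgroup.mem_top g)

lemma coprime_mem {G : Type*} [Group G] (C : Subgroup G) (g : G) (a b : ℕ) (h : Nat.Coprime a b)
    (ha : g ^ a ∈ C) (hb : g ^ b ∈ C) : g ∈ C := by
  have h1 := Nat.gcd_eq_gcd_ab a b
  rw [h] at h1
  have : g = (g ^ a) ^ (a.gcdA b) * (g ^ b) ^ (a.gcdB b) := by
    rw [← zpow_natCast g a, ← zpow_natCast g b, ← zpow_mul, ← zpow_mul, ← zpow_add, ← h1]; simp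
  rw [this]
  exact C.mul_mem (C.zpow_mem ha _) (C.zpow_mem hb _)

lemma conj_pow_mem {G : Type*} [Group G] {A : Subgroup G} {g : G}
    (h : ∀ a ∈ A, g * a * g⁻¹ ∈ A) (k : ℕ) : ∀ a ∈ A, g ^ k * a * (g ^ k)⁻¹ ∈ A := by
  induction k with
  | zero => simp
  | succ k ih =>
    intro a ha
    have := h _ (ih a ha)
    rw [pow_succ']
    simpa [mul_assoc] using this

lemma X_small {G : Type*} [Group G] [Finite G] {n : ℕ} (hn : n ≤ 2) (ρ : G →* GL (Fin n) ℂ)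
    (hρ : Function.Injective ρ)
    (A : Subgroup G) (hA : ∀ a ∈ A, ∀ b ∈ A, a * b = b * a)
    (g : G) (hg : Odd (orderOf g)) (hgA : ∀ a ∈ A, g * a * g⁻¹ ∈ A) :
    ∀ a ∈ A, g * a = a * g := by
  obtain ⟨l, hl, -, -, hπ⟩ := weights ρ hρ A hA
  obtain ⟨π, hπ⟩ := hπ g (fun a => ⟨g * a * g⁻¹, hgA a a.2⟩) (by intro a; simp)
  have h2 : ∀ π : Equiv.Perm (Fin n), ∀ i, π (π i) = i := by
    interval_cases n <;> decide
  intro a ha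
  have h3 : (⟨g * (g * a * g⁻¹) * g⁻¹, hgA _ (hgA a ha)⟩ : A) = ⟨a, ha⟩ := by
    apply hl
    intro i
    have e1 := hπ i ⟨g * a * g⁻¹, hgA a ha⟩
    have e2 := hπ (π i) ⟨a, ha⟩
    rw [h2] at e2
    exact e1.trans e2
  have h4 : g * (g * a * g⁻¹) * g⁻¹ = a := congrArg Subtype.val h3
  have h5 : Commute (g ^ 2) a := by
    change g ^ 2 * a = a * g ^ 2
    calc g ^ 2 * a = (g * (g * a * g⁻¹) * g⁻¹) * g ^ 2 := by simp [pow_succ, mul_assoc]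
      _ = _ := by rw [h4]
  obtain ⟨k, hk⟩ := hg
  have h6 : g = (g ^ 2) ^ (k + 1) := by
    rw [← pow_mul, show 2 * (k + 1) = orderOf g + 1 by omega, pow_succ, pow_orderOf_eq_one, one_mul]
  have h7 := h5.pow_left (k + 1)
  rw [← h6] at h7
  exact h7

variable {G : Type*} [Group G] [Finite G] {ρ : G →* GL (Fin 3) ℂ}

lemma PCtx.X (h : PCtx G ρ)
    (A : Subgroup G) (hA : ∀ a ∈ A, ∀ b ∈ A, a * b = b * a)
    (g : G) (hg : Odd (orderOf g)) (hgA : ∀ a ∈ A, g * a * g⁻¹ ∈ A) :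
    ∀ a ∈ A, g * a = a * g := by
  have hAH : A ≤ A ⊔ Subgroup.zpowers g := le_sup_left
  have hgH : g ∈ A ⊔ Subgroup.zpowers g :=
    (le_sup_right : _ ≤ A ⊔ Subgroup.zpowers g) (Subgroup.mem_zpowers g)
  by_cases htop : A ⊔ Subgroup.zpowers g = ⊤
  · have hnorm : A.Normal := by
      have h1 : (⊤ : Subgroup G) ≤ Subgroup.normalizer (A : Set G) := by
        rw [← htop, sup_le_iff]
        refine ⟨Subgroup.le_normalizer, ?_⟩
        rw [Subgroup.zpowers_le]
        have := Set.Finite.subset (Set.toFinite (A : Set G)) (le_refl _)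
        rw [Subgroup.mem_normalizer_iff]
        intro a
        refine ⟨hgA a, fun ha => ?_⟩
        have h2 := conj_pow_mem hgA (orderOf g - 1) _ ha
        have h3 : g ^ (orderOf g - 1) = g⁻¹ := by
          rw [eq_inv_iff_mul_eq_one, ← pow_succ, Nat.sub_add_cancel (orderOf_pos g), pow_orderOf_eq_one]
        rw [h3] at h2
        simpa [mul_assoc] using h2
      exact Subgroup.normalizer_eq_top_iff.mp (top_le_iff.mp h1)
    have hle : commutator G ≤ A := by
      have h1 : ∀ x : G ⧸ A, x ∈ Subgroup.zpowers (QuotientGroup.mk' A g) := by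
        have h2 : Subgroup.map (QuotientGroup.mk' A) (A ⊔ Subgroup.zpowers g) = ⊤ := by
          rw [htop]; exact Subgroup.map_top_of_surjective _ (QuotientGroup.mk'_surjective A)
        rw [Subgroup.map_sup, MonoidHom.map_zpowers] at h2
        have h3 : Subgroup.map (QuotientGroup.mk' A) A = ⊥ := by
          rw [Subgroup.map_eq_bot_iff]; simp
        rw [h3, bot_sup_eq] at h2
        intro x; rw [h2]; trivial
      rw [commutator_def, Subgroup.commutator_le]
      intro a _ b _
      rw [← QuotientGroup.eq_one_iff]
      have : ∀ x y : G ⧸ A, x * y = y * x := by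
        intro x y
        obtain ⟨i, rfl⟩ := h1 x
        obtain ⟨j, rfl⟩ := h1 y
        simp only [← zpow_add, add_comm]
      have h5 := this a b
      rw [commutatorElement_def]
      simp only [QuotientGroup.mk_mul, QuotientGroup.mk_inv]
      rw [h5]; group
    rw [h.perf] at hle
    exact fun a ha => hA g (hle trivial) a ha
  · obtain ⟨n, hn, f, hf⟩ := h.small _ htop
    intro a ha
    have := X_small hn f hf (A.subgroupOf (A ⊔ Subgroup.zpowers g)) ?_ ⟨g, hgH⟩ ?_ ?_ ⟨a, hAH ha⟩ ?_
    · exact congrArg Subtype.val this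
    · intro x hx y hy
      exact Subtype.ext (hA x hx y hy)
    · rwa [Subgroup.orderOf_mk]
    · intro x hx; exact hgA x hx
    · exact ha

/-- an element acting as a `3`-cycle (or trivially) on the weights centralizes -/
lemma PCtx.cube (h : PCtx G ρ)
    (A : Subgroup G) (hA : ∀ a ∈ A, ∀ b ∈ A, a * b = b * a)
    (g : G) (hgA : ∀ a ∈ A, g * a * g⁻¹ ∈ A) (h3 : ∀ a ∈ A, g ^ 3 * a = a * g ^ 3) :
    ∀ a ∈ A, g * a = a * g := by
  have h1 : Odd (orderOf (g ^ (2 ^ (orderOf g).factorization 2))) := by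
    rw [orderOf_pow, Nat.gcd_eq_right (Nat.ordProj_dvd _ _)]
    have := Nat.not_dvd_ordCompl Nat.prime_two (orderOf_pos g).ne'
    exact Nat.not_even_iff_odd.mp fun he => this he.two_dvd
  have h2 := h.X A hA _ h1 (conj_pow_mem hgA _)
  have h4 : g ∈ Subgroup.centralizer (A : Set G) := by
    apply coprime_mem _ g (2 ^ (orderOf g).factorization 2) 3
    · exact Nat.Coprime.pow_left _ (by norm_num)
    · rw [Subgroup.mem_centralizer_iff]; intro a ha; exact (h2 a ha).symm
    · rw [Subgroup.mem_centralizer_iff]; intro a ha; exact (h3 a ha).symm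
  rw [Subgroup.mem_centralizer_iff] at h4
  exact fun a ha => (h4 a ha).symm

lemma PCtx.W (h : PCtx G ρ)
    (A : Subgroup G) (hA : ∀ a ∈ A, ∀ b ∈ A, a * b = b * a)
    (n m : G) (hn : ∀ a ∈ A, n * a * n⁻¹ ∈ A) (hm : ∀ a ∈ A, m * a * m⁻¹ ∈ A)
    (hn' : ¬ ∀ a ∈ A, n * a = a * n) (hm' : ¬ ∀ a ∈ A, m * a = a * m) :
    ∀ a ∈ A, (n * m) * a = a * (n * m) := by
  obtain ⟨l, hl, -, -, hπ⟩ := weights ρ h.inj A hA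
  have key : ∀ g : G, ∀ hg : (∀ a ∈ A, g * a * g⁻¹ ∈ A), ∀ π : Equiv.Perm (Fin 3), π ^ 3 = 1 →
      (∀ i, ∀ a : A, l i ⟨g * a * g⁻¹, hg a a.2⟩ = l (π i) a) → ∀ a ∈ A, g * a = a * g := by
    intro g hg π hp hh
    apply h.cube A hA g hg
    intro a ha
    have : (⟨g * (g * (g * a * g⁻¹) * g⁻¹) * g⁻¹, hg _ (hg _ (hg a ha))⟩ : A) = ⟨a, ha⟩ := by
      apply hl
      intro i
      have e1 := hh i ⟨_, hg _ (hg a ha)⟩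
      have e2 := hh (π i) ⟨_, hg a ha⟩
      have e3 := hh (π (π i)) ⟨a, ha⟩
      have : π (π (π i)) = i := by
        have := congrArg (fun σ : Equiv.Perm (Fin 3) => σ i) hp
        simpa [pow_succ] using this
      rw [this] at e3
      exact e1.trans (e2.trans e3)
    have h4 : g * (g * (g * a * g⁻¹) * g⁻¹) * g⁻¹ = a := congrArg Subtype.val this
    calc g ^ 3 * a = (g * (g * (g * a * g⁻¹) * g⁻¹) * g⁻¹) * g ^ 3 := by simp [pow_succ, mul_assoc]
      _ = _ := by rw [h4]
  obtain ⟨πn, hπn⟩ := hπ n (fun a => ⟨n * a * n⁻¹, hn a a.2⟩) (by intro a; simp)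
  obtain ⟨πm, hπm⟩ := hπ m (fun a => ⟨m * a * m⁻¹, hm a a.2⟩) (by intro a; simp)
  have hn3 : πn ^ 3 ≠ 1 := fun h3 => hn' (key n hn πn h3 hπn)
  have hm3 : πm ^ 3 ≠ 1 := fun h3 => hm' (key m hm πm h3 hπm)
  have hnm : ∀ a ∈ A, (n * m) * a * (n * m)⁻¹ ∈ A := by
    intro a ha
    have := hn _ (hm a ha)
    simpa [mul_assoc] using this
  have hdec : ∀ σ τ : Equiv.Perm (Fin 3), σ ^ 3 ≠ 1 → τ ^ 3 ≠ 1 → (τ * σ) ^ 3 = 1 := by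
    set_option maxRecDepth 100000 in decide
  refine key (n * m) hnm (πm * πn) (hdec _ _ hn3 hm3) ?_
  intro i a
  have e1 := hπn i ⟨_, hm a a.2⟩
  have e2 := hπm (πn i) a
  have : (⟨n * m * a * (n * m)⁻¹, hnm a a.2⟩ : A) = ⟨n * (m * a * m⁻¹) * n⁻¹, hn _ (hm a a.2)⟩ := by
    apply Subtype.ext; simp [mul_assoc]
  rw [this]
  exact e1.trans e2

/-- transfer into an abelian Sylow subgroup of a perfect group -/
lemma perf_transfer (hp : commutator G = ⊤) {p : ℕ} [Fact p.Prime] (P : Sylow p G)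
    (hP : ∀ a ∈ P, ∀ b ∈ P, a * b = b * a) (x : G) (hx : x ∈ P)
    (hfix : ∀ n : G, (∀ a ∈ P, n * a * n⁻¹ ∈ P) → n * x = x * n) : x = 1 := by
  have hcomm : IsMulCommutative P := ⟨⟨fun a b => Subtype.ext (hP a a.2 b b.2)⟩⟩
  have key : ∀ (k : ℕ) (g₀ : G), g₀⁻¹ * x ^ k * g₀ ∈ (P : Subgroup G) → g₀⁻¹ * x ^ k * g₀ = x ^ k := by
    intro k g₀ h
    obtain ⟨n, hn, h⟩ := P.conj_eq_normalizer_conj_of_mem (x ^ k) g₀ (P.pow_mem hx k) h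
    rw [h]
    have h1 := hfix n (fun a ha => (Subgroup.mem_normalizer_iff.mp hn a).mp ha)
    have h2 : Commute n (x ^ k) := Commute.pow_right h1 k
    rw [mul_assoc, ← h2.eq]; simp
  let : CommGroup P := { (inferInstance : Group P) with mul_comm := fun a b => Subtype.ext (hP a a.2 b b.2) }
  have h1 := MonoidHom.transfer_eq_pow (MonoidHom.id P) x key
  rw [perf_hom hp] at h1
  have h2 : x ^ (P : Subgroup G).index = 1 := (congrArg Subtype.val h1).symm
  obtain ⟨k, hk⟩ := P.isPGroup' ⟨x, hx⟩
  have hk' : x ^ p ^ k = 1 := congrArg Subtype.val hk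
  have h3 := P.not_dvd_index
  have h4 := coprime_mem (⊥ : Subgroup G) x (p ^ k) (P : Subgroup G).index
    (Nat.Coprime.pow_left _ ((Nat.Prime.coprime_iff_not_dvd Fact.out).mpr h3)) hk' h2
  exact h4

end A2

section A3

lemma odd_pgroup_small {P : Type*} [Group P] [Finite P] {p : ℕ} [Fact p.Prime] (hp2 : p ≠ 2)
    (hP : IsPGroup p P) {n : ℕ} (hn : n ≤ 2) (f : P →* GL (Fin n) ℂ) (hf : Function.Injective f) :
    ∀ a b : P, a * b = b * a := by
  by_contra hne
  have hZ : Subgroup.center P ≠ ⊤ := by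
    intro h
    apply hne
    intro a b
    have : b ∈ Subgroup.center P := by rw [h]; trivial
    exact Subgroup.mem_center_iff.mp this a
  have hnt : Nontrivial (P ⧸ Subgroup.center P) := by
    by_contra h
    rw [not_nontrivial_iff_subsingleton] at h
    exact hZ (QuotientGroup.subgroup_eq_top_of_subsingleton _ h)
  have hq : IsPGroup p (P ⧸ Subgroup.center P) := hP.to_quotient _
  have hc := hq.center_nontrivial
  obtain ⟨⟨xb, hxb⟩, hx1⟩ := exists_ne (1 : Subgroup.center (P ⧸ Subgroup.center P))
  obtain ⟨x, rfl⟩ := QuotientGroup.mk'_surjective _ xb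
  let A := (Subgroup.zpowers (QuotientGroup.mk' (Subgroup.center P) x)).comap (QuotientGroup.mk' (Subgroup.center P))
  have hxA : x ∈ A := Subgroup.mem_zpowers _
  have hrep : ∀ a ∈ A, ∃ k : ℤ, ∃ z ∈ Subgroup.center P, a = x ^ k * z := by
    rintro a ⟨k, hk⟩
    refine ⟨k, (x ^ k)⁻¹ * a, ?_, by simp⟩
    have hk' : ((x ^ k : P) : P ⧸ Subgroup.center P) = (a : P ⧸ Subgroup.center P) := by
      simpa using hk
    exact QuotientGroup.eq.mp hk'
  have hA : ∀ a ∈ A, ∀ b ∈ A, a * b = b * a := by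
    intro a ha b hb
    obtain ⟨k, z, hz, rfl⟩ := hrep a ha
    obtain ⟨j, w, hw, rfl⟩ := hrep b hb
    have hz' := Subgroup.mem_center_iff.mp hz
    have hw' := Subgroup.mem_center_iff.mp hw
    have e1 : Commute (x ^ k) (x ^ j) := (Commute.refl x).zpow_zpow k j
    have e2 : Commute z (x ^ j) := (hz' _).symm
    have e3 : Commute (x ^ k) w := hw' _
    have e4 : Commute z w := hw' _
    exact (e1.mul_left e2).mul_right (e3.mul_left e4)
  have hodd : ∀ g : P, Odd (orderOf g) := by
    intro g
    obtain ⟨k, hk⟩ := (IsPGroup.iff_orderOf.mp hP) g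
    rw [hk]
    exact ((Fact.out : p.Prime).odd_of_ne_two hp2).pow
  have hnorm : ∀ g : P, ∀ a ∈ A, g * a * g⁻¹ ∈ A := by
    rintro g a ⟨k, hk⟩
    refine ⟨k, ?_⟩
    simp only at hk ⊢
    have hcen : (QuotientGroup.mk' (Subgroup.center P) x) ^ k ∈ Subgroup.center (P ⧸ Subgroup.center P) :=
      Subgroup.zpow_mem _ hxb k
    rw [map_mul, map_mul, ← hk, Subgroup.mem_center_iff.mp hcen, map_inv, mul_inv_cancel_right]
  apply hx1
  apply Subtype.ext
  change QuotientGroup.mk' (Subgroup.center P) x = 1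
  rw [QuotientGroup.mk'_apply, QuotientGroup.eq_one_iff, Subgroup.mem_center_iff]
  intro g
  exact X_small hn f hf A hA g (hodd g) (hnorm g) x hxA

variable {G : Type*} [Group G] [Finite G] {ρ : G →* GL (Fin 3) ℂ}

lemma PCtx.nontriv (h : PCtx G ρ) : Nontrivial G := by
  by_contra hn
  rw [not_nontrivial_iff_subsingleton] at hn
  exact h.nosmall 0 (by norm_num) 1 (Function.injective_of_subsingleton _)

lemma PCtx.sylow_ne_top (h : PCtx G ρ) {p : ℕ} [Fact p.Prime] (P : Sylow p G) :
    (P : Subgroup G) ≠ ⊤ := by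
  intro ht
  have h1 : IsPGroup p (⊤ : Subgroup G) := by rw [← ht]; exact P.2
  have h2 : IsPGroup p G := h1.of_equiv Subgroup.topEquiv
  have h3 := h2.isNilpotent
  have := h.nontriv
  have h4 := Group.IsSolvable.commutator_lt_top_of_nontrivial G
  rw [h.perf] at h4
  exact lt_irrefl _ h4

lemma PCtx.odd_sylow (h : PCtx G ρ) {p : ℕ} [Fact p.Prime] (hp2 : p ≠ 2) (P : Sylow p G) :
    ∀ a ∈ P, ∀ b ∈ P, a * b = b * a := by
  obtain ⟨n, hn, f, hf⟩ := h.small _ (h.sylow_ne_top P)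
  intro a ha b hb
  exact congrArg Subtype.val (odd_pgroup_small hp2 P.2 hn f hf ⟨a, ha⟩ ⟨b, hb⟩)

lemma PCtx.inverter (h : PCtx G ρ) {p : ℕ} [Fact p.Prime] (hp2 : p ≠ 2) (P : Sylow p G) :
    ∃ g : G, ∀ x ∈ P, g * x * g⁻¹ = x⁻¹ := by
  have hab := h.odd_sylow hp2 P
  by_cases hall : ∀ n : G, (∀ a ∈ P, n * a * n⁻¹ ∈ P) → ∀ a ∈ P, n * a = a * n
  · refine ⟨1, fun x hx => ?_⟩
    rw [perf_transfer h.perf P hab x hx (fun n hn => hall n hn x hx)]; simp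
  · push Not at hall
    obtain ⟨g, hg, hg'⟩ := hall
    have hg'' : ¬ ∀ a ∈ P, g * a = a * g := by push Not; exact hg'
    refine ⟨g, fun x hx => ?_⟩
    have hgx := hg x hx
    have hgg := h.W P hab g g hg hg hg'' hg''
    have hy : x * (g * x * g⁻¹) = 1 := by
      apply perf_transfer h.perf P hab _ (P.mul_mem hx hgx)
      have hcg : Commute g (x * (g * x * g⁻¹)) := by
        change g * (x * (g * x * g⁻¹)) = (x * (g * x * g⁻¹)) * g
        rw [hab _ hx _ hgx]
        have := hgg x hx
        calc g * (g * x * g⁻¹ * x) = ((g * g) * x) * g⁻¹ * x := by simp only [mul_assoc]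
          _ = x * (g * g) * g⁻¹ * x := by rw [this]
          _ = x * g * x := by simp [mul_assoc]
          _ = (x * (g * x * g⁻¹)) * g := by simp [mul_assoc]
          _ = _ := by rw [hab _ hx _ hgx]
      intro n hn
      by_cases hc : ∀ a ∈ P, n * a = a * n
      · exact hc _ (P.mul_mem hx hgx)
      · have h1 : Commute (n * g) (x * (g * x * g⁻¹)) := h.W P hab n g hn hg hc hg'' _ (P.mul_mem hx hgx)
        have h2 := h1.mul_left hcg.inv_left
        rw [mul_inv_cancel_right] at h2
        exact h2
    exact (inv_eq_of_mul_eq_one_right hy).symm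

lemma PCtx.det_one (h : PCtx G ρ) (g : G) : (ρ g : Matrix (Fin 3) (Fin 3) ℂ).det = 1 := by
  have := perf_hom h.perf (Matrix.GeneralLinearGroup.det.comp ρ) g
  have := congrArg Units.val this
  simpa using this

end A3

section A4

variable {G : Type*} [Group G] [Finite G] {ρ : G →* GL (Fin 3) ℂ}

/-- the matrix form of a linear representation -/
noncomputable def toGL {W : Type*} [AddCommGroup W] [Module ℂ W] [FiniteDimensional ℂ W]
    (f : G →* Module.End ℂ W) : G →* GL (Fin (Module.finrank ℂ W)) ℂ :=
  (Units.map (LinearMap.toMatrixAlgEquiv (Module.finBasis ℂ W)).toAlgHom.toRingHom.toMonoidHom).comp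
    f.toHomUnits

lemma toGL_eq_one {W : Type*} [AddCommGroup W] [Module ℂ W] [FiniteDimensional ℂ W]
    (f : G →* Module.End ℂ W) (g : G) (hg : toGL f g = 1) : f g = 1 := by
  have := congrArg Units.val hg
  change LinearMap.toMatrixAlgEquiv (Module.finBasis ℂ W) (f g) = 1 at this
  rw [← map_one (LinearMap.toMatrixAlgEquiv (Module.finBasis ℂ W))] at this
  exact (LinearMap.toMatrixAlgEquiv (Module.finBasis ℂ W)).injective this

lemma PCtx.exists_ker (h : PCtx G ρ) {W : Type*} [AddCommGroup W] [Module ℂ W]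
    [FiniteDimensional ℂ W] (hW : Module.finrank ℂ W ≤ 2)
    (f : G →* Module.End ℂ W) : ∃ g ≠ 1, f g = 1 := by
  have := h.nosmall _ hW (toGL f)
  rw [injective_iff_map_eq_one] at this
  push Not at this
  obtain ⟨g, hg, hg1⟩ := this
  exact ⟨g, hg1, toGL_eq_one f g hg⟩

lemma gl_one_eq_one {d : ℕ} (hd : d = 1) (M : GL (Fin d) ℂ)
    (h : Matrix.GeneralLinearGroup.det M = 1) : M = 1 := by
  subst hd
  have h' := congrArg Units.val h
  apply Units.ext
  ext i j
  fin_cases i; fin_cases j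
  simpa using h'

lemma PCtx.triv_one (h : PCtx G ρ) {W : Type*} [AddCommGroup W] [Module ℂ W]
    [FiniteDimensional ℂ W] (hW : Module.finrank ℂ W = 1)
    (f : G →* Module.End ℂ W) (g : G) : f g = 1 :=
  toGL_eq_one f g (gl_one_eq_one hW _ (perf_hom h.perf (Matrix.GeneralLinearGroup.det.comp (toGL f)) g))

lemma unipotent_finite {V : Type*} [AddCommGroup V] [Module ℂ V] (T : Module.End ℂ V) (k : ℕ)
    (hk : 0 < k) (hT : T ^ k = 1) (h2 : (T - 1) * (T - 1) = 0) : T = 1 := by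
  have key : ∀ j : ℕ, T ^ j = 1 + (j : ℂ) • (T - 1) := by
    intro j
    induction j with
    | zero => simp
    | succ j ih =>
      have h3 : T = 1 + (T - 1) := by abel
      rw [pow_succ, ih]
      conv_lhs => rw [h3]
      rw [mul_add, mul_one, add_mul, one_mul, smul_mul_assoc]
      have h4 : (1 + (T - 1) - 1) * (T - 1) = 0 := by rw [← h3]; exact h2
      rw [h4, smul_zero, add_zero, ← h3]
      push_cast
      rw [add_smul, one_smul, add_assoc]
  have h1 := key k
  rw [hT] at h1
  have h5 : (k : ℂ) • (T - 1) = 0 := by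
    have := h1.symm
    rwa [add_eq_left] at this
  rcases smul_eq_zero.mp h5 with h6 | h6
  · exact absurd h6 (by exact_mod_cast hk.ne')
  · exact sub_eq_zero.mp h6

lemma PCtx.irred (h : PCtx G ρ) (E : Submodule ℂ (Fin 3 → ℂ))
    (hE : ∀ g, ∀ v ∈ E, Matrix.toLin' (ρ g : Matrix (Fin 3) (Fin 3) ℂ) v ∈ E) (hbot : E ≠ ⊥) :
    E = ⊤ := by
  by_contra htop
  let r : Representation ℂ G (Fin 3 → ℂ) :=
    { toFun := fun g => Matrix.toLin' (ρ g : Matrix (Fin 3) (Fin 3) ℂ)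
      map_one' := by simp; rfl
      map_mul' := fun a b => by simp [Matrix.toLin'_mul]; rfl }
  let r1 := r.subrepresentation E hE
  let r2 := r.quotient E hE
  have hd := E.finrank_quotient_add_finrank
  rw [Module.finrank_fin_fun] at hd
  have hpos : 0 < Module.finrank ℂ E := by
    rw [Module.finrank_pos_iff, Submodule.nontrivial_iff_ne_bot]; exact hbot
  have hlt : Module.finrank ℂ E < 3 := by
    have := Submodule.finrank_lt htop
    rwa [Module.finrank_fin_fun] at this
  obtain ⟨g, hg1, hg, hg'⟩ : ∃ g : G, g ≠ 1 ∧ r1 g = 1 ∧ r2 g = 1 := by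
    rcases (by omega : Module.finrank ℂ E = 1 ∨ Module.finrank ℂ E = 2) with h1 | h1
    · obtain ⟨g, hg, hg'⟩ := h.exists_ker (by omega) r2
      exact ⟨g, hg, h.triv_one h1 r1 g, hg'⟩
    · obtain ⟨g, hg, hg'⟩ := h.exists_ker (by omega) r1
      exact ⟨g, hg, hg', h.triv_one (by omega) r2 g⟩
  have hT : r g = 1 := by
    apply unipotent_finite (r g) (Nat.card G) Nat.card_pos
    · rw [← map_pow, pow_card_eq_one', map_one]
    · ext1 i
      apply LinearMap.ext_ring
      have hmem : ∀ v, (r g - 1) v ∈ E := by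
        intro v
        have := LinearMap.congr_fun hg' (Submodule.Quotient.mk v)
        change Submodule.Quotient.mk (r g v) = Submodule.Quotient.mk v at this
        exact (Submodule.Quotient.eq E).mp this
      have hz : ∀ v ∈ E, (r g - 1) v = 0 := by
        intro v hv
        have := congrArg Subtype.val (LinearMap.congr_fun hg ⟨v, hv⟩)
        change r g v = v at this
        simp [this]
      exact hz _ (hmem _)
  apply hg1
  apply h.inj
  rw [map_one]
  apply Units.ext
  have : Matrix.toLin' (ρ g : Matrix (Fin 3) (Fin 3) ℂ) = Matrix.toLin' 1 := by
    rw [Matrix.toLin'_one]; exact hT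
  exact Matrix.toLin'.injective this

lemma PCtx.schur (h : PCtx G ρ) (M : Matrix (Fin 3) (Fin 3) ℂ)
    (hM : ∀ g, M * (ρ g : Matrix (Fin 3) (Fin 3) ℂ) = ρ g * M) : ∃ c : ℂ, M = c • 1 := by
  obtain ⟨μ, hμ⟩ := Module.End.exists_eigenvalue (Matrix.toLin' M)
  have hE := h.irred (Module.End.eigenspace (Matrix.toLin' M) μ) ?_ hμ
  · refine ⟨μ, Matrix.toLin'.injective ?_⟩
    apply LinearMap.ext
    intro v
    have : v ∈ Module.End.eigenspace (Matrix.toLin' M) μ := by rw [hE]; trivial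
    rw [Module.End.mem_eigenspace_iff] at this
    rw [this]; simp
  · intro g v hv
    rw [Module.End.mem_eigenspace_iff] at hv ⊢
    rw [← Matrix.toLin'_mul_apply, hM, Matrix.toLin'_mul_apply, hv, map_smul]

lemma diag_commutes {d : Fin 3 → ℂ} (hd : Function.Injective d) (M : Matrix (Fin 3) (Fin 3) ℂ)
    (hM : M * Matrix.diagonal d = Matrix.diagonal d * M) : M = Matrix.diagonal (fun i => M i i) := by
  ext i j
  have := congrFun (congrFun hM i) j
  rw [Matrix.mul_diagonal, Matrix.diagonal_mul] at this
  by_cases hij : i = j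
  · subst hij; simp
  · rw [Matrix.diagonal_apply_ne _ hij]
    have h1 : (d j - d i) * M i j = 0 := by linear_combination this
    rcases mul_eq_zero.mp h1 with h2 | h2
    · exact absurd (hd (sub_eq_zero.mp h2)).symm hij
    · exact h2

lemma odd_root {x : ℂ} {n : ℕ} (hn : Odd n) (h1 : x ^ n = 1) (h2 : x * x = 1) : x = 1 := by
  obtain ⟨k, rfl⟩ := hn
  rw [pow_succ, pow_mul, pow_two, h2, one_pow, one_mul] at h1
  exact h1

lemma three_alg {a b c : ℂ} {n : ℕ} (hn : Odd n) (ha : a ^ n = 1) (hb : b ^ n = 1) (hc : c ^ n = 1)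
    (h1 : a * b * c = 1) (h2 : a + b + c = b * c + a * c + a * b) (hne : ¬ (a = 1 ∧ b = 1 ∧ c = 1)) :
    a ≠ b ∧ a ≠ c ∧ b ≠ c := by
  have h3 : (a - 1) * (b - 1) * (c - 1) = 0 := by linear_combination h1 + h2
  have key : ∀ x y z : ℂ, x ^ n = 1 → y ^ n = 1 → z ^ n = 1 → x * y * z = 1 → x = 1 →
      ¬ (x = 1 ∧ y = 1 ∧ z = 1) → x ≠ y ∧ x ≠ z ∧ y ≠ z := by
    rintro x y z - hy hz h rfl hne
    rw [one_mul] at h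
    refine ⟨?_, ?_, ?_⟩
    · rintro rfl; apply hne; simpa using h
    · rintro rfl; apply hne; simpa using h
    · rintro rfl
      have := odd_root hn hy h
      exact hne ⟨rfl, this, this⟩
  rcases mul_eq_zero.mp h3 with h4 | h4
  · rcases mul_eq_zero.mp h4 with h5 | h5
    · exact key a b c ha hb hc h1 (sub_eq_zero.mp h5) hne
    · have := key b a c hb ha hc (by linear_combination h1) (sub_eq_zero.mp h5) (by tauto)
      exact ⟨this.1.symm, this.2.2, this.2.1⟩
  · have := key c a b hc ha hb (by linear_combination h1) (sub_eq_zero.mp h4) (by tauto)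
    exact ⟨this.2.2, this.1.symm, this.2.1.symm⟩

lemma PCtx.CA0 (h : PCtx G ρ) (y : G) (hy : y ≠ 1) (hodd : Odd (orderOf y)) (g : G)
    (hg : g * y * g⁻¹ = y⁻¹) (a b : G) (ha : a * y = y * a) (hb : b * y = y * b) : a * b = b * a := by
  have hA : ∀ a ∈ Subgroup.zpowers y, ∀ b ∈ Subgroup.zpowers y, a * b = b * a := by
    rintro _ ⟨i, rfl⟩ _ ⟨j, rfl⟩
    exact (Commute.refl y).zpow_zpow i j
  obtain ⟨ρ', hinj, htr, hdet, l, hl⟩ := diag_rep ρ h.inj _ hA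
  have hly := hl y (Subgroup.mem_zpowers y)
  have hli := hl y⁻¹ (Subgroup.inv_mem _ (Subgroup.mem_zpowers y))
  have hmul : ∀ i, l i y * l i y⁻¹ = 1 := by
    intro i
    have : (ρ' y : Matrix (Fin 3) (Fin 3) ℂ) * ρ' y⁻¹ = 1 := by
      rw [← Units.val_mul, ← map_mul]; simp
    rw [hly, hli, Matrix.diagonal_mul_diagonal] at this
    have := congrFun (congrFun this i) i
    simpa using this
  have hpow : ∀ i, l i y ^ orderOf y = 1 := by
    intro i
    have : (ρ' y : Matrix (Fin 3) (Fin 3) ℂ) ^ orderOf y = 1 := by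
      rw [← Units.val_pow_eq_pow_val, ← map_pow, pow_orderOf_eq_one]; simp
    rw [hly, Matrix.diagonal_pow] at this
    have := congrFun (congrFun this i) i
    simpa using this
  have hdet1 : l 0 y * l 1 y * l 2 y = 1 := by
    have := hdet y
    rw [h.det_one, hly, Matrix.det_diagonal, Fin.prod_univ_three] at this
    exact this
  have htr1 : l 0 y + l 1 y + l 2 y = l 0 y⁻¹ + l 1 y⁻¹ + l 2 y⁻¹ := by
    have e1 : (ρ' y⁻¹ : Matrix (Fin 3) (Fin 3) ℂ).trace = (ρ' y : Matrix (Fin 3) (Fin 3) ℂ).trace := by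
      rw [← hg, map_mul, map_mul, Units.val_mul, Units.val_mul, Matrix.trace_mul_comm, ← mul_assoc,
        ← Units.val_mul, ← map_mul]
      simp
    rw [hly, hli, Matrix.trace_diagonal, Matrix.trace_diagonal, Fin.sum_univ_three, Fin.sum_univ_three] at e1
    exact e1.symm
  have hne : ¬ (l 0 y = 1 ∧ l 1 y = 1 ∧ l 2 y = 1) := by
    rintro ⟨h0, h1, h2⟩
    apply hy
    apply hinj
    rw [map_one]
    apply Units.ext
    rw [hly, Units.val_one, ← Matrix.diagonal_one]
    congr 1
    ext i
    fin_cases i <;> assumption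
  have e0 : l 0 y⁻¹ = l 1 y * l 2 y := by linear_combination l 1 y * l 2 y * hmul 0 - l 0 y⁻¹ * hdet1
  have e1 : l 1 y⁻¹ = l 0 y * l 2 y := by linear_combination l 0 y * l 2 y * hmul 1 - l 1 y⁻¹ * hdet1
  have e2 : l 2 y⁻¹ = l 0 y * l 1 y := by linear_combination l 0 y * l 1 y * hmul 2 - l 2 y⁻¹ * hdet1
  rw [e0, e1, e2] at htr1
  obtain ⟨n1, n2, n3⟩ := three_alg hodd (hpow 0) (hpow 1) (hpow 2) hdet1 htr1 hne
  have hdi : Function.Injective (fun i => l i y) := by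
    intro i j hij
    fin_cases i <;> fin_cases j
    all_goals first
      | rfl
      | exact absurd hij n1
      | exact absurd hij n2
      | exact absurd hij n3
      | exact absurd hij n1.symm
      | exact absurd hij n2.symm
      | exact absurd hij n3.symm
  have hdiag : ∀ c : G, c * y = y * c → (ρ' c : Matrix (Fin 3) (Fin 3) ℂ) =
      Matrix.diagonal (fun i => (ρ' c : Matrix (Fin 3) (Fin 3) ℂ) i i) := by
    intro c hc
    apply diag_commutes hdi
    rw [← hly, ← Units.val_mul, ← Units.val_mul, ← map_mul, ← map_mul, hc]
  apply hinj
  apply Units.ext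
  rw [map_mul, map_mul, Units.val_mul, Units.val_mul, hdiag a ha, hdiag b hb,
    Matrix.diagonal_mul_diagonal, Matrix.diagonal_mul_diagonal]
  congr 1
  ext i
  ring

lemma PCtx.CA (h : PCtx G ρ) (y : G) (hy : y ≠ 1) (hodd : Odd (orderOf y))
    (a b : G) (ha : a * y = y * a) (hb : b * y = y * b) : a * b = b * a := by
  have h1 : orderOf y ≠ 1 := by rwa [Ne, orderOf_eq_one_iff]
  obtain ⟨p, hp, hpd⟩ := Nat.exists_prime_and_dvd h1
  have : Fact p.Prime := ⟨hp⟩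
  have hp2 : p ≠ 2 := by
    rintro rfl
    exact (Nat.not_even_iff_odd.mpr hodd) (even_iff_two_dvd.mpr hpd)
  have ho : orderOf (y ^ (orderOf y / p)) = p := orderOf_pow_orderOf_div (orderOf_pos y).ne' hpd
  have hpg : IsPGroup p (Subgroup.zpowers (y ^ (orderOf y / p))) := by
    apply IsPGroup.of_card (n := 1)
    rw [Nat.card_zpowers, ho, pow_one]
  obtain ⟨P, hP⟩ := hpg.exists_le_sylow
  obtain ⟨g, hg⟩ := h.inverter hp2 P
  refine h.CA0 (y ^ (orderOf y / p)) ?_ ?_ g (hg _ (hP (Subgroup.mem_zpowers _))) a b ?_ ?_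
  · intro h0
    rw [h0, orderOf_one] at ho
    exact hp.one_lt.ne ho
  · rw [ho]; exact hp.odd_of_ne_two hp2
  · exact Commute.pow_right ha _
  · exact Commute.pow_right hb _

end A4

section A5

abbrev M2 := Matrix (Fin 2) (Fin 2) ℂ

lemma comm2 (U M : M2) (hU : ∀ c : ℂ, U ≠ c • (1 : M2)) (hM : M * U = U * M) :
    ∃ a b : ℂ, M = a • (1 : M2) + b • U := by
  have e00 := congrFun (congrFun hM 0) 0
  have e01 := congrFun (congrFun hM 0) 1
  have e10 := congrFun (congrFun hM 1) 0
  simp only [Matrix.mul_apply, Fin.sum_univ_two] at e00 e01 e10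
  by_cases h01 : U 0 1 = 0
  · by_cases h10 : U 1 0 = 0
    · have h11 : U 0 0 - U 1 1 ≠ 0 := by
        intro h
        apply hU (U 0 0)
        ext i j
        fin_cases i <;> fin_cases j <;> simp [h01, h10]
        linear_combination -h
      refine ⟨M 0 0 - (M 0 0 - M 1 1) / (U 0 0 - U 1 1) * U 0 0, (M 0 0 - M 1 1) / (U 0 0 - U 1 1), ?_⟩
      have m01 : M 0 1 = 0 := by
        apply mul_left_cancel₀ h11
        rw [h01] at e01
        linear_combination -e01
      have m10 : M 1 0 = 0 := by
        apply mul_left_cancel₀ h11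
        rw [h10] at e10
        linear_combination e10
      ext i j
      fin_cases i <;> fin_cases j <;> simp [h01, h10, m01, m10]
      field_simp
      ring
    · refine ⟨M 0 0 - M 1 0 / U 1 0 * U 0 0, M 1 0 / U 1 0, ?_⟩
      ext i j
      fin_cases i <;> fin_cases j <;> simp [h10]
      · field_simp; linear_combination e00
      · field_simp; linear_combination e10
  · refine ⟨M 0 0 - M 0 1 / U 0 1 * U 0 0, M 0 1 / U 0 1, ?_⟩
    ext i j
    fin_cases i <;> fin_cases j <;> simp [h01]
    · field_simp; linear_combination -e00
    · field_simp; linear_combination -e01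

lemma nonscalar2 (U : M2) (h : U * U = 1) (h1 : U ≠ 1) (h2 : U ≠ -1) (c : ℂ) : U ≠ c • (1 : M2) := by
  rintro rfl
  have := congrFun (congrFun h 0) 0
  simp at this
  rcases mul_self_eq_one_iff.mp this with rfl | rfl
  · simp at h1
  · simp at h2

lemma swap_small {S : Type*} [Group S] [Finite S] (hS : IsPGroup 2 S)
    (hna : ¬ ∀ a b : S, a * b = b * a) {n : ℕ} (hn : n ≤ 2) (f : S →* GL (Fin n) ℂ)
    (hf : Function.Injective f) (z u : S) (hz1 : z ≠ 1) (hz : z * z = 1) (hzc : ∀ s, s * z = z * s)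
    (hu1 : u ≠ 1) (hu : u * u = 1) (huz : u ≠ z) : ∃ p : S, p * u * p⁻¹ = u * z := by
  have hn2 : n = 2 := by
    interval_cases n
    · exfalso; apply hna; intro a b; apply hf; apply Subsingleton.elim
    · exfalso; apply hna; intro a b; apply hf
      rw [map_mul, map_mul]
      apply Units.ext
      ext i j
      fin_cases i; fin_cases j
      simp [Matrix.mul_apply, mul_comm]
    · rfl
  subst hn2
  let F : S → M2 := fun s => (f s : M2)
  have Fm : ∀ a b, F (a * b) = F a * F b := fun a b => by simp [F]
  have F1 : F 1 = 1 := by simp [F]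
  have Fi : Function.Injective F := fun a b hab => hf (Units.ext hab)
  have hab : ∀ v : S, (∀ c : ℂ, F v ≠ c • (1 : M2)) → ∀ a b : S, a * v = v * a → b * v = v * b → a * b = b * a := by
    intro v hv a b ha hb
    obtain ⟨a1, a2, e⟩ := comm2 (F v) (F a) hv (by rw [← Fm, ← Fm, ha])
    obtain ⟨b1, b2, e'⟩ := comm2 (F v) (F b) hv (by rw [← Fm, ← Fm, hb])
    apply Fi
    rw [Fm, Fm, e, e']
    have c1 : Commute (a1 • (1 : M2) + a2 • F v) (F v) :=
      ((Commute.one_left (F v)).smul_left a1).add_left ((Commute.refl (F v)).smul_left a2)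
    exact ((Commute.one_right _).smul_right b1).add_right (c1.smul_right b2)
  have hFz : F z = -1 := by
    by_contra hne
    apply hna
    intro a b
    refine hab z (nonscalar2 _ ?_ ?_ hne) a b (hzc a) (hzc b)
    · rw [← Fm, hz, F1]
    · rw [← F1]; exact fun h => hz1 (Fi h)
  have hUns := nonscalar2 (F u) (by rw [← Fm, hu, F1]) (by rw [← F1]; exact fun h => hu1 (Fi h))
    (by rw [← hFz]; exact fun h => huz (Fi h))
  have hC : Subgroup.centralizer {u} ≠ ⊤ := by
    intro ht
    apply hna
    have hh : ∀ a : S, a * u = u * a := by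
      intro a
      have : a ∈ Subgroup.centralizer {u} := by rw [ht]; trivial
      rw [Subgroup.mem_centralizer_singleton_iff] at this
      exact this
    exact fun a b => hab u hUns a b (hh a) (hh b)
  have hnil := hS.isNilpotent
  have hlt := Group.normalizerCondition_of_isNilpotent (G := S) _ hC.lt_top
  obtain ⟨p, hpN, hpC⟩ := SetLike.exists_of_lt hlt
  have huC : u ∈ Subgroup.centralizer {u} := by
    rw [Subgroup.mem_centralizer_singleton_iff]
  have hmem := (Subgroup.mem_normalizer_iff.mp hpN u).mp huC
  rw [Subgroup.mem_centralizer_singleton_iff] at hmem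
  refine ⟨p, ?_⟩
  set u' := p * u * p⁻¹ with hu'
  have hu'2 : u' * u' = 1 := by
    rw [hu']
    calc p * u * p⁻¹ * (p * u * p⁻¹) = p * (u * u) * p⁻¹ := by group
      _ = 1 := by rw [hu]; group
  have hback : ∀ w : S, (∀ s, s * w = w * s) → u' = w → u = w := by
    intro w hw h
    have : u = p⁻¹ * u' * p := by rw [hu']; group
    rw [this, h, hw p⁻¹]; group
  obtain ⟨a, b, e⟩ := comm2 (F u) (F u') hUns (by rw [← Fm, ← Fm, hmem])
  have hUU : F u * F u = 1 := by rw [← Fm, hu, F1]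
  have hsq : (a * a + b * b - 1) • (1 : M2) + (2 * a * b) • F u = 0 := by
    have h1 : F u' * F u' = 1 := by rw [← Fm, hu'2, F1]
    rw [e] at h1
    have : (a • (1 : M2) + b • F u) * (a • (1 : M2) + b • F u)
       = (a * a + b * b) • (1 : M2) + (2 * a * b) • F u := by
      simp only [add_mul, mul_add, smul_mul_assoc, mul_smul_comm, one_mul, mul_one, hUU]
      module
    rw [this] at h1
    calc _ = ((a*a+b*b)•(1:M2) + (2*a*b)•F u) - 1 := by module
      _ = 0 := sub_eq_zero.mpr h1
  have hab0 : 2 * a * b = 0 := by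
    by_contra h0
    apply hUns (-(a * a + b * b - 1) / (2 * a * b))
    have : (2 * a * b) • F u = (-(a * a + b * b - 1)) • (1 : M2) := by
      rw [neg_smul]; exact eq_neg_of_add_eq_zero_right hsq
    rw [div_eq_inv_mul, mul_smul, ← this, smul_smul, inv_mul_cancel₀ h0, one_smul]
  rw [hab0, zero_smul, add_zero] at hsq
  have hs : a * a + b * b - 1 = 0 := by
    have := congrFun (congrFun hsq 0) 0
    simpa using this
  rcases mul_eq_zero.mp hab0 with h0 | h0
  · have ha0 : a = 0 := by simpa using h0
    subst ha0
    have hb : b * b = 1 := by linear_combination hs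
    rcases mul_self_eq_one_iff.mp hb with rfl | rfl
    · exfalso
      apply hpC
      rw [Subgroup.mem_centralizer_singleton_iff]
      have : u' = u := by apply Fi; rw [e]; simp
      rw [hu'] at this
      exact mul_inv_eq_iff_eq_mul.mp this
    · apply Fi
      change F u' = F (u * z)
      rw [e, Fm, hFz]; simp
  · subst h0
    exfalso
    have ha : a * a = 1 := by linear_combination hs
    rcases mul_self_eq_one_iff.mp ha with rfl | rfl
    · exact hu1 (hback 1 (by simp) (Fi (by rw [e, F1]; simp)))
    · exact huz (hback z hzc (Fi (by rw [e, hFz]; simp)))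

variable {G : Type*} [Group G] [Finite G] {ρ : G →* GL (Fin 3) ℂ}

lemma PCtx.even (h : PCtx G ρ) : 2 ∣ Nat.card G := by
  by_contra h2
  have hnt := h.nontriv
  obtain ⟨p, hp, hpd⟩ := Nat.exists_prime_and_dvd (Finite.one_lt_card (α := G)).ne'
  have : Fact p.Prime := ⟨hp⟩
  have hp2 : p ≠ 2 := by rintro rfl; exact h2 hpd
  obtain ⟨x, hx⟩ := exists_prime_orderOf_dvd_card' p hpd
  have hodd : ∀ g : G, Odd (orderOf g) := by
    intro g
    rw [← Nat.not_even_iff_odd, even_iff_two_dvd]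
    exact fun hh => h2 (hh.trans (orderOf_dvd_natCard g))
  have hpg : IsPGroup p (Subgroup.zpowers x) := by
    apply IsPGroup.of_card (n := 1)
    rw [Nat.card_zpowers, hx, pow_one]
  obtain ⟨P, hP⟩ := hpg.exists_le_sylow
  obtain ⟨g, hg⟩ := h.inverter hp2 P
  have hxP := hP (Subgroup.mem_zpowers x)
  have h1 := h.X P (h.odd_sylow hp2 P) g (hodd g)
    (fun a ha => by rw [hg a ha]; exact P.inv_mem ha) x hxP
  have h3 := hg x hxP
  rw [h1, mul_inv_cancel_right] at h3
  have h4 : x ^ 2 = 1 := by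
    rw [pow_two]; nth_rewrite 2 [h3]; simp
  have h5 := orderOf_dvd_of_pow_eq_one h4
  rw [hx] at h5
  exact hp2 ((Nat.prime_dvd_prime_iff_eq hp Nat.prime_two).mp h5)

lemma PCtx.two_nonab (h : PCtx G ρ) (S : Sylow 2 G) : ¬ ∀ a ∈ S, ∀ b ∈ S, a * b = b * a := by
  intro hab
  have htriv : ∀ x ∈ S, x = 1 := by
    intro x hx
    apply perf_transfer h.perf S hab x hx
    intro n hn
    have hn' : n ∈ Subgroup.centralizer ((S : Subgroup G) : Set G) := by
      have ho := (orderOf_pos n).ne'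
      apply coprime_mem _ n (2 ^ (orderOf n).factorization 2) (orderOf n / 2 ^ (orderOf n).factorization 2)
      · exact (Nat.coprime_ordCompl Nat.prime_two ho).pow_left _
      · rw [Subgroup.mem_centralizer_iff]
        intro a ha
        refine (h.X S hab _ ?_ (conj_pow_mem hn _) a ha).symm
        rw [orderOf_pow, Nat.gcd_eq_right (Nat.ordProj_dvd _ _)]
        have := Nat.not_dvd_ordCompl Nat.prime_two ho
        exact Nat.not_even_iff_odd.mp fun he => this he.two_dvd
      · set m := n ^ (orderOf n / 2 ^ (orderOf n).factorization 2) with hm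
        have hpg : IsPGroup 2 (Subgroup.zpowers m) := by
          apply IsPGroup.of_card (n := (orderOf n).factorization 2)
          rw [Nat.card_zpowers, hm, orderOf_pow, Nat.gcd_eq_right (Nat.ordCompl_dvd _ _),
            Nat.div_div_self (Nat.ordProj_dvd _ _) ho]
        have hmN : m ∈ Subgroup.normalizer ((S : Subgroup G) : Set G) := by
          have := conj_pow_mem hn (orderOf n / 2 ^ (orderOf n).factorization 2)
          rw [← hm] at this
          rw [Subgroup.mem_normalizer_iff]
          intro a
          refine ⟨this a, fun ha => ?_⟩
          have h2 := conj_pow_mem this (orderOf m - 1) _ ha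
          have h3 : m ^ (orderOf m - 1) = m⁻¹ := by
            rw [eq_inv_iff_mul_eq_one, ← pow_succ, Nat.sub_add_cancel (orderOf_pos m), pow_orderOf_eq_one]
          rw [h3] at h2
          simpa [mul_assoc] using h2
        have h5 := hpg.inf_normalizer_sylow S
        have h6 : m ∈ Subgroup.zpowers m ⊓ Subgroup.normalizer (S : Set G) :=
          ⟨Subgroup.mem_zpowers m, hmN⟩
        rw [h5] at h6
        rw [Subgroup.mem_centralizer_iff]
        intro a ha
        exact hab a ha m h6.2
    exact (Subgroup.mem_centralizer_iff.mp hn' x hx).symm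
  obtain ⟨x, hx⟩ := exists_prime_orderOf_dvd_card' 2 h.even
  have hpg : IsPGroup 2 (Subgroup.zpowers x) := by
    apply IsPGroup.of_card (n := 1)
    rw [Nat.card_zpowers, hx, pow_one]
  obtain ⟨g, hg⟩ := hpg.exists_le_sylow
  obtain ⟨c, rfl⟩ := MulAction.exists_smul_eq G S g
  have h1 := hg (Subgroup.mem_zpowers x)
  have h2 := (Subgroup.mem_pointwise_smul_iff_inv_smul_mem (a := MulAut.conj c) (S := (S : Subgroup G)) (x := x)).mp h1
  have h3 := htriv _ h2
  have h4 : x = 1 := by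
    have h5 : c⁻¹ * x * c = 1 := by simpa using h3
    calc x = c * (c⁻¹ * x * c) * c⁻¹ := by group
      _ = 1 := by rw [h5]; group
  rw [h4, orderOf_one] at hx
  norm_num at hx

end A5

section A6
variable {G : Type*} [Group G] [Finite G] {ρ : G →* GL (Fin 3) ℂ}

structure CInv (z : G) : Prop where
  ne : z ≠ 1
  sq : z * z = 1
  cen : ∃ S : Sylow 2 G, z ∈ S ∧ ∀ s ∈ S, s * z = z * s

lemma CInv.conj {z : G} (hz : CInv z) (c : G) : CInv (c * z * c⁻¹) := by
  obtain ⟨h1, h2, S, hS, h3⟩ := hz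
  refine ⟨?_, ?_, c • S, ?_, ?_⟩
  · intro h
    exact h1 (by simpa using h)
  · calc c * z * c⁻¹ * (c * z * c⁻¹) = c * (z * z) * c⁻¹ := by group
      _ = 1 := by rw [h2]; group
  · refine (Subgroup.mem_pointwise_smul_iff_inv_smul_mem (a := MulAut.conj c) (S := (S : Subgroup G))).mpr ?_
    have : (MulAut.conj c)⁻¹ • (c * z * c⁻¹) = z := by simp; group
    rw [this]; exact hS
  · intro s hs
    have h4 := (Subgroup.mem_pointwise_smul_iff_inv_smul_mem (a := MulAut.conj c) (S := (S : Subgroup G))).mp hs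
    have h5 : (MulAut.conj c)⁻¹ • s = c⁻¹ * s * c := by simp
    rw [h5] at h4
    have h6 := h3 _ h4
    calc s * (c * z * c⁻¹) = c * ((c⁻¹ * s * c) * z) * c⁻¹ := by group
      _ = _ := by rw [h6]; group

lemma CInv.inv {z : G} (hz : CInv z) : z⁻¹ = z := inv_eq_of_mul_eq_one_left hz.sq

lemma PCtx.exists_cinv (h : PCtx G ρ) : ∃ z : G, CInv z := by
  let S : Sylow 2 G := default
  have hnt : Nontrivial S := by
    by_contra hn
    rw [not_nontrivial_iff_subsingleton] at hn
    apply h.two_nonab S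
    intro a ha b hb
    have : (⟨a, ha⟩ : S) = ⟨b, hb⟩ := Subsingleton.elim _ _
    have : a = b := congrArg Subtype.val this
    rw [this]
  have hc := S.2.center_nontrivial
  have h2 : IsPGroup 2 (Subgroup.center S) := S.2.to_subgroup _
  obtain ⟨k, hk, hk2⟩ := h2.nontrivial_iff_card.mp hc
  obtain ⟨x, hx⟩ := exists_prime_orderOf_dvd_card' (G := Subgroup.center S) 2 (hk2 ▸ dvd_pow_self 2 hk.ne')
  have hxx : x * x = 1 := by
    have := pow_orderOf_eq_one x
    rwa [hx, pow_two] at this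
  refine ⟨((x : S) : G), ?_, ?_, S, (x : S).2, ?_⟩
  · intro h1
    have : x = 1 := Subtype.ext (Subtype.ext h1)
    rw [this, orderOf_one] at hx
    norm_num at hx
  · have := congrArg (fun y : Subgroup.center S => ((y : S) : G)) hxx
    simpa using this
  · intro s hs
    have := Subgroup.mem_center_iff.mp x.2 ⟨s, hs⟩
    exact congrArg Subtype.val this

lemma PCtx.swap (h : PCtx G ρ) {z u : G} (hz : CInv z) (hu1 : u ≠ 1) (hu : u * u = 1) (huz : u ≠ z)
    (hc : u * z = z * u) : ∃ p : G, p * z = z * p ∧ p * u * p⁻¹ = u * z := by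
  obtain ⟨h1, h2, S, hS, h3⟩ := hz
  have hSC : (S : Subgroup G) ≤ Subgroup.centralizer {z} := fun s hs =>
    Subgroup.mem_centralizer_singleton_iff.mpr (h3 s hs)
  let u' : Subgroup.centralizer {z} := ⟨u, Subgroup.mem_centralizer_singleton_iff.mpr hc⟩
  have hu2 : u' ^ 2 = 1 := by rw [pow_two]; exact Subtype.ext hu
  have hpg : IsPGroup 2 (Subgroup.zpowers u') := by
    obtain ⟨k, hk, hk2⟩ := (Nat.dvd_prime_pow Nat.prime_two (m := 1) (i := orderOf u')).mp
      (by rw [pow_one]; exact orderOf_dvd_of_pow_eq_one hu2)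
    apply IsPGroup.of_card (n := k)
    rw [Nat.card_zpowers, hk2]
  obtain ⟨Q, hQ⟩ := hpg.exists_le_sylow
  obtain ⟨c, rfl⟩ := MulAction.exists_smul_eq (Subgroup.centralizer {z}) (S.subtype hSC) Q
  have h40 := hQ (Subgroup.mem_zpowers u')
  have h4 := (Subgroup.mem_pointwise_smul_iff_inv_smul_mem (a := MulAut.conj c) (x := u')
    (S := ((S.subtype hSC : Sylow 2 (Subgroup.centralizer {z})) : Subgroup (Subgroup.centralizer {z})))).mp h40
  have h5 : (MulAut.conj c)⁻¹ • u' = c⁻¹ * u' * c := by simp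
  rw [h5] at h4
  have h6 : (c : G)⁻¹ * u * c ∈ S := h4
  have hcz : (c : G) * z = z * c := Subgroup.mem_centralizer_singleton_iff.mp c.2
  have hcz' : (c : G)⁻¹ * z = z * (c : G)⁻¹ := (Commute.inv_left (show Commute (c : G) z from hcz))
  obtain ⟨n, hn, f, hf⟩ := h.small _ (h.sylow_ne_top S)
  obtain ⟨p, hp⟩ := swap_small (S := S) S.2 (fun hab => h.two_nonab S fun a ha b hb =>
    congrArg Subtype.val (hab ⟨a, ha⟩ ⟨b, hb⟩)) hn f hf ⟨z, hS⟩ ⟨_, h6⟩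
    (fun hh => h1 (congrArg Subtype.val hh)) (Subtype.ext h2)
    (fun s => Subtype.ext (h3 s s.2))
    (fun hh => hu1 (by simpa [mul_assoc, inv_mul_eq_one] using congrArg Subtype.val hh))
    (Subtype.ext (by
      change (c : G)⁻¹ * u * c * ((c : G)⁻¹ * u * c) = 1
      calc _ = (c : G)⁻¹ * (u * u) * c := by group
        _ = 1 := by rw [hu]; group))
    (fun hh => huz (by
      have h7 : (c : G)⁻¹ * u * c = z := congrArg Subtype.val hh
      calc u = c * ((c : G)⁻¹ * u * c) * (c : G)⁻¹ := by group
        _ = z := by rw [h7, hcz]; group))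
  have hp' : (p : G) * ((c : G)⁻¹ * u * c) * (p : G)⁻¹ = ((c : G)⁻¹ * u * c) * z := congrArg Subtype.val hp
  have hpz := h3 p p.2
  refine ⟨c * p * (c : G)⁻¹, ?_, ?_⟩
  · calc (c : G) * p * (c : G)⁻¹ * z = c * p * ((c : G)⁻¹ * z) := by group
      _ = c * (p * z) * (c : G)⁻¹ := by rw [hcz']; group
      _ = (c * z) * p * (c : G)⁻¹ := by rw [hpz]; group
      _ = _ := by rw [hcz]; group
  · calc (c : G) * p * (c : G)⁻¹ * u * ((c : G) * p * (c : G)⁻¹)⁻¹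
        = c * ((p : G) * ((c : G)⁻¹ * u * c) * (p : G)⁻¹) * (c : G)⁻¹ := by group
      _ = u * (c * z) * (c : G)⁻¹ := by rw [hp']; group
      _ = u * z := by rw [hcz]; group

lemma norm_closure {s : Set G} {p : G} (hp : ∀ a ∈ s, p * a * p⁻¹ ∈ Subgroup.closure s) :
    ∀ a ∈ Subgroup.closure s, p * a * p⁻¹ ∈ Subgroup.closure s := by
  have : Subgroup.closure s ≤ (Subgroup.closure s).comap (MulAut.conj p).toMonoidHom := by
    rw [Subgroup.closure_le]
    intro a ha
    exact hp a ha
  exact fun a ha => this ha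

lemma PCtx.cinv_isolated (h : PCtx G ρ) {z u : G} (hz : CInv z) (hu : CInv u)
    (hc : u * z = z * u) : u = z := by
  by_contra hne
  obtain ⟨p, hp1, hp2⟩ := h.swap hz hu.ne hu.sq hne hc
  obtain ⟨q, hq1, hq2⟩ := h.swap hu hz.ne hz.sq (Ne.symm hne) hc.symm
  let V := Subgroup.closure {z, u}
  have hzV : z ∈ V := Subgroup.subset_closure (by simp)
  have huV : u ∈ V := Subgroup.subset_closure (by simp)
  have hV : ∀ a ∈ V, ∀ b ∈ V, a * b = b * a := by
    have hh : ∀ x ∈ ({z, u} : Set G), ∀ y ∈ ({z, u} : Set G), x * y = y * x := by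
      rintro x (rfl | rfl) y (rfl | rfl)
      · rfl
      · exact hc.symm
      · exact hc
      · rfl
    intro a ha b hb
    have := (Subgroup.isMulCommutative_closure hh).is_comm.comm ⟨a, ha⟩ ⟨b, hb⟩
    exact congrArg Subtype.val this
  have hw := h.W V hV p q (norm_closure ?_) (norm_closure ?_) ?_ ?_ u huV
  · have : p * u * p⁻¹ = u := by
      calc p * u * p⁻¹ = (p * (u * q)) * (p * q)⁻¹ := by group
        _ = ((p * q) * u) * (p * q)⁻¹ := by rw [← hq1]; group
        _ = u := by rw [hw]; group
    rw [this] at hp2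
    exact hz.ne (by simpa using hp2)
  · rintro a (rfl | rfl)
    · rw [hp1]; simpa using hzV
    · rw [hp2]; exact V.mul_mem huV hzV
  · rintro a (rfl | rfl)
    · rw [hq2]; exact V.mul_mem hzV huV
    · rw [hq1]; simpa using huV
  · intro hh
    rw [hh u huV] at hp2
    exact hz.ne (by simpa using hp2)
  · intro hh
    rw [hh z hzV] at hq2
    exact hu.ne (by simpa using hq2)

lemma PCtx.cinv_odd (h : PCtx G ρ) {z u : G} (hz : CInv z) (hu : CInv u) : Odd (orderOf (z * u)) := by
  by_contra hodd
  rw [Nat.not_odd_iff_even] at hodd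
  obtain ⟨m, hm⟩ := hodd
  set t := z * u with ht
  have hu' : u = z * t := by rw [ht, ← mul_assoc, hz.sq, one_mul]
  have hzt : z * t * z⁻¹ = t⁻¹ := by
    rw [← hu', ht, mul_inv_rev, hz.inv, hu.inv]
  have hzk : ∀ k : ℕ, z * t ^ k = (t ^ k)⁻¹ * z := by
    intro k
    rw [← inv_pow, ← hzt, conj_pow]; group
  have hmpos : 0 < m := by have := orderOf_pos t; omega
  have hw1 : t ^ m ≠ 1 := fun hh => by
    have := orderOf_le_of_pow_eq_one hmpos hh; omega
  have hww : t ^ m * t ^ m = 1 := by rw [← pow_add, ← hm, pow_orderOf_eq_one]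
  have hcw : z * t ^ m = t ^ m * z := by
    rw [hzk, inv_eq_of_mul_eq_one_left hww]
  have hC : CInv (z * t ^ m) := by
    rcases Nat.even_or_odd' m with ⟨k, hk | hk⟩
    · have := hz.conj (t ^ k)⁻¹
      have e : (t ^ k)⁻¹ * z * (t ^ k)⁻¹⁻¹ = z * t ^ m := by
        rw [← hzk, hk, two_mul, pow_add]; group
      rwa [e] at this
    · have := hu.conj (t ^ k)⁻¹
      have e : (t ^ k)⁻¹ * u * (t ^ k)⁻¹⁻¹ = z * t ^ m := by
        rw [hu', ← mul_assoc, ← hzk, hk]; group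
      rwa [e] at this
  have := h.cinv_isolated hz hC (by rw [mul_assoc, ← hcw])
  exact hw1 (by simpa using this)
end A6

section A7
variable {G : Type*} [Group G] [Finite G] {ρ : G →* GL (Fin 3) ℂ}

def Om (A : Subgroup G) : Prop := ∃ y : G, y ≠ 1 ∧ Odd (orderOf y) ∧ A = Subgroup.centralizer {y}

lemma mem_cen {x y : G} : x ∈ Subgroup.centralizer {y} ↔ x * y = y * x :=
  Subgroup.mem_centralizer_singleton_iff

def oddSub (A : Subgroup G) : Subgroup G := Subgroup.closure {x | x ∈ A ∧ Odd (orderOf x)}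

lemma odd_conj {x : G} (g : G) : orderOf (g * x * g⁻¹) = orderOf x :=
  orderOf_injective (MulAut.conj g).toMonoidHom (MulAut.conj g).injective x

lemma Om.ab (h : PCtx G ρ) {A : Subgroup G} (hA : Om A) : ∀ a ∈ A, ∀ b ∈ A, a * b = b * a := by
  obtain ⟨y, h1, h2, rfl⟩ := hA
  intro a ha b hb
  exact h.CA y h1 h2 a b (mem_cen.mp ha) (mem_cen.mp hb)

lemma Om.eq (h : PCtx G ρ) {A : Subgroup G} (hA : Om A) {x : G} (hx : x ∈ A) (hx1 : x ≠ 1)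
    (hxo : Odd (orderOf x)) : A = Subgroup.centralizer {x} := by
  have hab := hA.ab h
  apply le_antisymm
  · intro a ha
    exact mem_cen.mpr (hab a ha x hx)
  · obtain ⟨y, h1, h2, rfl⟩ := hA
    intro a ha
    rw [mem_cen] at *
    exact h.CA x hx1 hxo a y ha hx.symm

lemma mem_oddSub (h : PCtx G ρ) {A : Subgroup G} (hA : Om A) {x : G} :
    x ∈ oddSub A ↔ x ∈ A ∧ Odd (orderOf x) := by
  have hab := hA.ab h
  refine ⟨fun hx => ?_, fun hx => Subgroup.subset_closure hx⟩
  induction hx using Subgroup.closure_induction with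
  | mem x hx => exact hx
  | one => exact ⟨A.one_mem, by simp⟩
  | inv x _ ih => exact ⟨A.inv_mem ih.1, by rw [orderOf_inv]; exact ih.2⟩
  | mul x y _ _ ihx ihy =>
    refine ⟨A.mul_mem ihx.1 ihy.1, ?_⟩
    have h1 : Commute x y := hab x ihx.1 y ihy.1
    exact Odd.of_dvd_nat (ihx.2.mul ihy.2) (h1.orderOf_mul_dvd_mul_orderOf)

lemma oddSub_le (h : PCtx G ρ) {A : Subgroup G} (hA : Om A) : oddSub A ≤ A :=
  fun _ hx => ((mem_oddSub h hA).mp hx).1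

lemma oddSub_odd (h : PCtx G ρ) {A : Subgroup G} (hA : Om A) : Odd (Nat.card (oddSub A)) := by
  rw [← Nat.not_even_iff_odd, even_iff_two_dvd]
  intro h2
  obtain ⟨x, hx⟩ := exists_prime_orderOf_dvd_card' 2 h2
  have := ((mem_oddSub h hA).mp x.2).2
  rw [Subgroup.orderOf_coe, hx] at this
  exact absurd this (by decide)

lemma oddSub_three (h : PCtx G ρ) {A : Subgroup G} (hA : Om A) : 3 ≤ Nat.card (oddSub A) := by
  have h1 := oddSub_odd h hA
  have h2 : Nat.card (oddSub A) ≠ 1 := by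
    rw [Ne, Subgroup.card_eq_one]
    intro hb
    obtain ⟨y, hy1, hyo, rfl⟩ := hA
    have : y ∈ oddSub (Subgroup.centralizer {y}) := Subgroup.subset_closure ⟨mem_cen.mpr rfl, hyo⟩
    rw [hb] at this
    exact hy1 this
  obtain ⟨k, hk⟩ := h1
  omega

lemma oddSub_centralizer (h : PCtx G ρ) {A : Subgroup G} (hA : Om A) {n : G}
    (hn : ∀ a ∈ A, n * a = a * n) : n ∈ A := by
  obtain ⟨y, hy1, hyo, rfl⟩ := hA
  exact mem_cen.mpr (hn y (mem_cen.mpr rfl))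

lemma not_two_pow {x : G} (hx : ∀ k : ℕ, x ^ (2 ^ k) ≠ 1) :
    ∃ k, x ^ (2 ^ k) ≠ 1 ∧ Odd (orderOf (x ^ (2 ^ k))) := by
  refine ⟨(orderOf x).factorization 2, hx _, ?_⟩
  rw [orderOf_pow, Nat.gcd_eq_right (Nat.ordProj_dvd _ _)]
  have := Nat.not_dvd_ordCompl Nat.prime_two (orderOf_pos x).ne'
  exact Nat.not_even_iff_odd.mp fun he => this he.two_dvd

lemma Om.eq_of (h : PCtx G ρ) {A A' : Subgroup G} (hA : Om A) (hA' : Om A') {x : G} (hx : x ∈ A)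
    (hx' : x ∈ A') (h2 : ∀ k : ℕ, x ^ (2 ^ k) ≠ 1) : A = A' := by
  obtain ⟨k, h3, h4⟩ := not_two_pow h2
  rw [hA.eq h (A.pow_mem hx _) h3 h4, hA'.eq h (A'.pow_mem hx' _) h3 h4]

/-- conjugate of a subgroup -/
def cj (g : G) (A : Subgroup G) : Subgroup G := A.map (MulAut.conj g).toMonoidHom

lemma mem_cj {g x : G} {A : Subgroup G} : x ∈ cj g A ↔ g⁻¹ * x * g ∈ A := by
  constructor
  · rintro ⟨a, ha, rfl⟩
    have : g⁻¹ * (MulAut.conj g).toMonoidHom a * g = a := by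
      simp; group
    rw [this]; exact ha
  · intro hx
    exact ⟨_, hx, by simp; group⟩

lemma Om.cj {A : Subgroup G} (hA : Om A) (g : G) : Om (cj g A) := by
  obtain ⟨y, hy1, hyo, rfl⟩ := hA
  refine ⟨g * y * g⁻¹, ?_, by rwa [odd_conj], ?_⟩
  · intro hh; exact hy1 (by simpa using hh)
  · ext x
    rw [mem_cj, mem_cen, mem_cen]
    constructor
    · intro hx
      calc x * (g * y * g⁻¹) = g * (g⁻¹ * x * g * y) * g⁻¹ := by group
        _ = _ := by rw [hx]; group
    · intro hx
      calc g⁻¹ * x * g * y = g⁻¹ * (x * (g * y * g⁻¹)) * g := by group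
        _ = _ := by rw [hx]; group

lemma cj_self_iff {A : Subgroup G} {g : G} : cj g A = A ↔ g ∈ Subgroup.normalizer (A : Set G) := by
  rw [Subgroup.mem_normalizer_iff]
  constructor
  · intro hh a
    have e : g⁻¹ * (g * a * g⁻¹) * g = a := by group
    conv_rhs => rw [← hh, mem_cj, e]
  · intro hh
    ext x
    rw [mem_cj, hh]
    have : g * (g⁻¹ * x * g) * g⁻¹ = x := by group
    rw [this]

lemma card_cj (g : G) (A : Subgroup G) : Nat.card (cj g A) = Nat.card A :=
  Subgroup.card_map_of_injective (MulAut.conj g).injective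

lemma oddSub_cj (h : PCtx G ρ) {A : Subgroup G} (hA : Om A) (g : G) :
    oddSub (cj g A) = cj g (oddSub A) := by
  ext x
  rw [mem_oddSub h (hA.cj g), mem_cj, mem_cj, mem_oddSub h hA]
  have : orderOf (g⁻¹ * x * g) = orderOf x := by simpa using odd_conj (x := x) g⁻¹
  rw [this]

lemma Om.normalizer_of (h : PCtx G ρ) {A : Subgroup G} (hA : Om A) {x g : G} (hx : x ∈ A)
    (h2 : ∀ k : ℕ, x ^ (2 ^ k) ≠ 1) (hg : g * x * g⁻¹ ∈ A) : g ∈ Subgroup.normalizer (A : Set G) := by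
  rw [← cj_self_iff]
  apply Om.eq_of h (hA.cj g) hA (x := g * x * g⁻¹) _ hg
  · intro k hk
    rw [conj_pow] at hk
    exact h2 k (by simpa using hk)
  · rw [mem_cj]
    have : g⁻¹ * (g * x * g⁻¹) * g = x := by group
    rwa [this]

lemma odd_two_pow {x : G} (hx : x ≠ 1) (ho : Odd (orderOf x)) (k : ℕ) : x ^ (2 ^ k) ≠ 1 := by
  intro hk
  have h1 := orderOf_dvd_of_pow_eq_one hk
  have h2 : Nat.Coprime (orderOf x) (2 ^ k) := (Nat.coprime_two_right.mpr ho).pow_right k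
  have := Nat.Coprime.eq_one_of_dvd h2 h1
  exact hx (orderOf_eq_one_iff.mp this)

lemma Om.norm_pair (h : PCtx G ρ) {A : Subgroup G} (hA : Om A) {n m : G}
    (hn : n ∈ Subgroup.normalizer (A : Set G)) (hm : m ∈ Subgroup.normalizer (A : Set G))
    (hn' : n ∉ A) (hm' : m ∉ A) : n * m ∈ A := by
  rw [Subgroup.mem_normalizer_iff] at hn hm
  apply oddSub_centralizer h hA
  exact h.W A (hA.ab h) n m (fun a ha => (hn a).mp ha) (fun a ha => (hm a).mp ha)
    (fun hh => hn' (oddSub_centralizer h hA hh)) (fun hh => hm' (oddSub_centralizer h hA hh))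

lemma Om.norm_card (h : PCtx G ρ) {A : Subgroup G} (hA : Om A) :
    Nat.card (Subgroup.normalizer (A : Set G)) ≤ 2 * Nat.card A := by
  by_cases hall : ∀ n ∈ Subgroup.normalizer (A : Set G), n ∈ A
  · have : Nat.card (Subgroup.normalizer (A : Set G)) ≤ Nat.card A :=
      Subgroup.card_le_of_le hall
    omega
  · push Not at hall
    obtain ⟨n, hn, hnA⟩ := hall
    have hsub : ((Subgroup.normalizer (A : Set G) : Subgroup G) : Set G) ⊆
        (A : Set G) ∪ (fun a => n⁻¹ * a) '' (A : Set G) := by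
      intro m hm
      by_cases hmA : m ∈ A
      · exact Or.inl hmA
      · exact Or.inr ⟨n * m, hA.norm_pair h hn hm hnA hmA, by simp⟩
    have h1 := Set.ncard_le_ncard hsub (Set.toFinite _)
    have h2 := Set.ncard_union_le (A : Set G) ((fun a => n⁻¹ * a) '' (A : Set G))
    have h3 := Set.ncard_image_le (s := (A : Set G)) (f := fun a => n⁻¹ * a) (Set.toFinite _)
    rw [← Nat.card_coe_set_eq (A : Set G)] at h2 h3
    rw [← Nat.card_coe_set_eq (Subgroup.normalizer (A : Set G) : Set G)] at h1
    change Nat.card (Subgroup.normalizer (A : Set G)) ≤ _ at h1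
    change _ ≤ Nat.card A + _ at h2
    change _ ≤ Nat.card A at h3
    omega

lemma Om.inverts (h : PCtx G ρ) {A : Subgroup G} (hA : Om A) {n : G}
    (hn : n ∈ Subgroup.normalizer (A : Set G)) (hn' : n ∉ A) :
    ∀ b ∈ oddSub A, n * b * n⁻¹ = b⁻¹ := by
  intro b hb
  have hb2 := (mem_oddSub h hA).mp hb
  have hab := hA.ab h
  have hnn := hA.norm_pair h hn hn hn' hn'
  rw [Subgroup.mem_normalizer_iff] at hn
  have hnb : n * b * n⁻¹ ∈ oddSub A :=
    (mem_oddSub h hA).mpr ⟨(hn b).mp hb2.1, by rw [odd_conj]; exact hb2.2⟩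
  have hnb2 := (mem_oddSub h hA).mp hnb
  have hc := (mem_oddSub h hA).mp ((oddSub A).mul_mem hb hnb)
  by_contra hne
  have hc1 : b * (n * b * n⁻¹) ≠ 1 := fun hh => hne (eq_inv_of_mul_eq_one_right hh)
  apply hn'
  rw [hA.eq h hc.1 hc1 hc.2, mem_cen]
  have e1 := hab _ hnn b hb2.1
  have e2 := hab b hb2.1 _ hnb2.1
  calc n * (b * (n * b * n⁻¹)) = (n * b * n⁻¹) * ((n * n) * b) * n⁻¹ := by group
    _ = ((n * b * n⁻¹) * b) * n := by rw [e1]; group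
    _ = _ := by rw [e2]

lemma Om.sylow (h : PCtx G ρ) {A : Subgroup G} (hA : Om A) {p : ℕ} (hp : p.Prime) (hp2 : p ≠ 2)
    (hpA : p ∣ Nat.card A) {k : ℕ} (hk : p ^ k ∣ Nat.card G) : p ^ k ∣ Nat.card (oddSub A) := by
  have : Fact p.Prime := ⟨hp⟩
  obtain ⟨x, hx⟩ := exists_prime_orderOf_dvd_card' p hpA
  have hx' : orderOf (x : G) = p := by rw [Subgroup.orderOf_coe, hx]
  have hpg : IsPGroup p (Subgroup.zpowers (x : G)) := by
    apply IsPGroup.of_card (n := 1)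
    rw [Nat.card_zpowers, hx', pow_one]
  obtain ⟨P, hP⟩ := hpg.exists_le_sylow
  have hxP := hP (Subgroup.mem_zpowers (x : G))
  have hab := h.odd_sylow hp2 P
  have hxA := hA.eq h x.2 (fun hh => by rw [hh, orderOf_one] at hx'; exact hp.one_lt.ne hx')
    (by rw [hx']; exact hp.odd_of_ne_two hp2)
  have hPB : (P : Subgroup G) ≤ oddSub A := by
    intro y hy
    rw [mem_oddSub h hA]
    constructor
    · rw [hxA, mem_cen]; exact hab y hy x hxP
    · obtain ⟨j, hj⟩ := IsPGroup.iff_orderOf.mp P.2 ⟨y, hy⟩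
      rw [← Subgroup.orderOf_coe] at hj
      rw [hj]
      exact (hp.odd_of_ne_two hp2).pow
  have h1 := Subgroup.card_dvd_of_le hPB
  refine dvd_trans ?_ h1
  exact Sylow.pow_dvd_card_of_pow_dvd_card P hk

lemma PCtx.exists_om (h : PCtx G ρ) {p : ℕ} (hp : p.Prime) (hp2 : p ≠ 2) (hpA : p ∣ Nat.card G) :
    ∃ A : Subgroup G, Om A ∧ p ∣ Nat.card A := by
  have : Fact p.Prime := ⟨hp⟩
  obtain ⟨x, hx⟩ := exists_prime_orderOf_dvd_card' p hpA
  refine ⟨Subgroup.centralizer {x}, ⟨x, ?_, ?_, rfl⟩, ?_⟩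
  · intro hh; rw [hh, orderOf_one] at hx; exact hp.one_lt.ne hx
  · rw [hx]; exact hp.odd_of_ne_two hp2
  · rw [← hx, ← Subgroup.orderOf_mk x (mem_cen.mpr rfl : x ∈ Subgroup.centralizer {x})]
    exact orderOf_dvd_natCard _

end A7

section A8
variable {G : Type*} [Group G] [Finite G] {ρ : G →* GL (Fin 3) ℂ}

noncomputable def chi (ρ : G →* GL (Fin 3) ℂ) (g : G) : ℂ := (ρ g : Matrix (Fin 3) (Fin 3) ℂ).trace

lemma chi_one : chi ρ (1 : G) = 3 := by simp [chi]

lemma chi_conj (g x : G) : chi ρ (g * x * g⁻¹) = chi ρ x := by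
  simp only [chi, map_mul, Units.val_mul]
  rw [Matrix.trace_mul_cycle, ← Units.val_mul, ← Units.val_mul, ← map_mul, ← map_mul]
  simp

lemma PCtx.chi_inv (h : PCtx G ρ) {z : G} (hz : CInv z) : chi ρ z * chi ρ z = 1 := by
  have hab : ∀ a ∈ Subgroup.zpowers z, ∀ b ∈ Subgroup.zpowers z, a * b = b * a := by
    rintro _ ⟨i, rfl⟩ _ ⟨j, rfl⟩
    simp only [← zpow_add, add_comm]
  obtain ⟨l, hl, htr, hdet, -⟩ := weights ρ h.inj _ hab
  let z' : Subgroup.zpowers z := ⟨z, Subgroup.mem_zpowers z⟩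
  have hzz : z' * z' = 1 := Subtype.ext hz.sq
  have h1 : ∀ i, l i z' = 1 ∨ l i z' = -1 := by
    intro i
    apply mul_self_eq_one_iff.mp
    rw [← map_mul, hzz, map_one]
  have h2 := hdet z'
  have h3 : chi ρ z = _ := htr z'
  have h4 : ¬ (l 0 z' = 1 ∧ l 1 z' = 1 ∧ l 2 z' = 1) := by
    rintro ⟨a, b, c⟩
    have := hl z' 1 (by intro i; rw [map_one]; fin_cases i <;> assumption)
    exact hz.ne (congrArg Subtype.val this)
  rw [h.det_one, Fin.prod_univ_three] at h2
  rw [h3, Fin.sum_univ_three]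
  rcases h1 0 with a | a <;> rcases h1 1 with b | b <;> rcases h1 2 with c | c <;>
    first
    | (exfalso; rw [a, b, c] at h2; norm_num at h2; done)
    | (rw [a, b, c]; norm_num; done)
    | exact absurd ⟨a, b, c⟩ h4

open Classical in
lemma PCtx.sum_class (h : PCtx G ρ) [Fintype G] {z : G} (hz : CInv z) (K : Finset G)
    (hK : ∀ x, x ∈ K ↔ ∃ g, x = g * z * g⁻¹) :
    3 * ∑ x ∈ K, chi ρ (z * x) = K.card := by
  obtain ⟨c, hc⟩ := h.schur (∑ x ∈ K, (ρ x : Matrix (Fin 3) (Fin 3) ℂ)) (by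
    intro g
    rw [Finset.sum_mul, Finset.mul_sum]
    refine Finset.sum_nbij' (fun x => g⁻¹ * x * g) (fun x => g * x * g⁻¹) ?_ ?_ ?_ ?_ ?_
    · intro x hx
      obtain ⟨y, rfl⟩ := (hK x).mp hx
      exact (hK _).mpr ⟨g⁻¹ * y, by group⟩
    · intro x hx
      obtain ⟨y, rfl⟩ := (hK x).mp hx
      exact (hK _).mpr ⟨g * y, by group⟩
    · intro x _; group
    · intro x _; group
    · intro x _
      rw [← Units.val_mul, ← Units.val_mul, ← map_mul, ← map_mul]
      congr 2; group)
  have h1 : ∑ x ∈ K, chi ρ x = 3 * c := by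
    have := congrArg Matrix.trace hc
    rw [Matrix.trace_sum] at this
    simpa [chi, mul_comm] using this
  have h2 : ∑ x ∈ K, chi ρ x = K.card * chi ρ z := by
    rw [Finset.sum_congr rfl (g := fun _ => chi ρ z)]
    · simp
    · intro x hx
      obtain ⟨y, rfl⟩ := (hK x).mp hx
      exact chi_conj y z
  have h3 : ∑ x ∈ K, chi ρ (z * x) = c * chi ρ z := by
    have := congrArg (fun M => Matrix.trace ((ρ z : Matrix (Fin 3) (Fin 3) ℂ) * M)) hc
    simp only [Finset.mul_sum, Matrix.trace_sum] at this
    simpa [chi] using this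
  rw [h3]
  have := h.chi_inv hz
  linear_combination (-chi ρ z) * h1 + chi ρ z * h2 + (K.card : ℂ) * this

lemma perm3 : ∀ π : Equiv.Perm (Fin 3), (∃ i, π i = i) ∨
    (∀ i j, π (π i) = j ∨ π (π (π (π i))) = j ∨ i = j) := by decide

lemma PCtx.sum_odd (h : PCtx G ρ) (B : Subgroup G) [Fintype B] (hB : ∀ a ∈ B, ∀ b ∈ B, a * b = b * a)
    (hodd : Odd (Nat.card B)) (hne : B ≠ ⊥) (z : G) (hz : ∀ b ∈ B, z * b * z⁻¹ = b⁻¹) :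
    ∑ b : B, chi ρ (b : G) = Nat.card B := by
  obtain ⟨l, hl, htr, hdet, hπ⟩ := weights ρ h.inj B hB
  obtain ⟨π, hπ⟩ := hπ z (fun b => b⁻¹) (by
    intro b
    have := hz b b.2
    exact mul_inv_eq_iff_eq_mul.mp this)
  have hroot : ∀ i, (∀ b, l i b * l i b = 1) → l i = 1 := by
    intro i hi
    ext b
    apply odd_root hodd _ (hi b)
    rw [← map_pow, pow_card_eq_one', map_one]
  have hinv : ∀ i b, l i b * l i b⁻¹ = 1 := by
    intro i b; rw [← map_mul]; simp
  have hnt : ¬ ∀ i, l i = 1 := by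
    intro hall
    apply hne
    rw [Subgroup.eq_bot_iff_forall]
    intro x hx
    have := hl ⟨x, hx⟩ 1 (by intro i; rw [hall i]; simp)
    exact congrArg Subtype.val this
  have hfix : ∃ i, l i = 1 := by
    rcases perm3 π with ⟨i, hi⟩ | hcyc
    · refine ⟨i, hroot i fun b => ?_⟩
      have := hπ i b
      rw [hi] at this
      have h2 := hinv i b
      rwa [this] at h2
    · refine ⟨0, hroot 0 fun b => ?_⟩
      have h1 : ∀ i, l (π (π i)) b = l i b := by
        intro i
        rw [← hπ, ← hπ, inv_inv]
      have h2 : ∀ i j, l i b = l j b := by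
        intro i j
        rcases hcyc i j with hh | hh | hh
        · rw [← hh, h1]
        · rw [← hh, h1, h1]
        · rw [hh]
      have h3 := hinv 0 b
      rwa [hπ, h2 (π 0) 0] at h3
  have hprod : ∀ b, l 0 b * l 1 b * l 2 b = 1 := by
    intro b
    rw [← Fin.prod_univ_three (fun i => l i b), ← hdet, h.det_one]
  have key : ∀ i j k : Fin 3, (∀ b, l i b * l j b * l k b = 1) →
      (l i = 1 → l j = 1 → l k = 1 → False) → l i = 1 →
      ∑ b, l i b + ∑ b, l j b + ∑ b, l k b = Nat.card B := by
    intro i j k h1 h2 h3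
    have hj : l j ≠ 1 := by
      intro hj
      apply h2 h3 hj
      ext b
      have := h1 b
      rw [h3, hj] at this
      simpa using this
    have hk : l k ≠ 1 := by
      intro hk
      apply h2 h3 _ hk
      ext b
      have := h1 b
      rw [h3, hk] at this
      simpa using this
    rw [sum_hom_units_eq_zero _ hj, sum_hom_units_eq_zero _ hk, h3]
    simp
  have hsum : ∑ b : B, chi ρ (b : G) = ∑ b, l 0 b + ∑ b, l 1 b + ∑ b, l 2 b := by
    rw [← Finset.sum_add_distrib, ← Finset.sum_add_distrib]
    apply Finset.sum_congr rfl
    intro b _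
    rw [← Fin.sum_univ_three (fun i => l i b), ← htr]; rfl
  rw [hsum]
  have hnt' : ¬ (l 0 = 1 ∧ l 1 = 1 ∧ l 2 = 1) := by
    rintro ⟨a, b, c⟩; exact hnt (by intro i; fin_cases i <;> assumption)
  obtain ⟨i, hi⟩ := hfix
  fin_cases i
  · exact key 0 1 2 hprod (fun a b c => hnt' ⟨a, b, c⟩) hi
  · rw [← key 1 0 2 (fun b => by rw [← hprod b]; ring) (fun a b c => hnt' ⟨b, a, c⟩) hi]; ring
  · rw [← key 2 0 1 (fun b => by rw [← hprod b]; ring) (fun a b c => hnt' ⟨b, c, a⟩) hi]; ring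

end A8

section A9
variable {G : Type*} [Group G] [Finite G] {ρ : G →* GL (Fin 3) ℂ}

lemma card_class (z : G) (K : Finset G) (hK : ∀ x, x ∈ K ↔ ∃ g, x = g * z * g⁻¹) :
    K.card = (Subgroup.centralizer {z}).index := by
  have h1 := MulAction.index_stabilizer (ConjAct G) z
  have h2 : MulAction.orbit (ConjAct G) z = (K : Set G) := by
    ext x
    rw [Finset.mem_coe, hK, MulAction.mem_orbit_iff]
    constructor
    · rintro ⟨g, rfl⟩
      exact ⟨ConjAct.ofConjAct g, rfl⟩
    · rintro ⟨g, rfl⟩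
      exact ⟨ConjAct.toConjAct g, rfl⟩
  rw [h2, Set.ncard_coe_finset] at h1
  rw [← h1]
  have h3 : (MulAction.stabilizer (ConjAct G) z).comap (ConjAct.toConjAct (G := G)).toMonoidHom
      = Subgroup.centralizer {z} := by
    ext g
    rw [Subgroup.mem_comap, MulAction.mem_stabilizer_iff, mem_cen]
    change g * z * g⁻¹ = z ↔ _
    rw [mul_inv_eq_iff_eq_mul]
  rw [← h3]
  exact (Subgroup.index_comap_of_surjective _ (ConjAct.toConjAct (G := G)).surjective).symm

lemma PCtx.count (h : PCtx G ρ) {z : G} (hz : CInv z) : ∃ Ω : Finset (Subgroup G),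
    (∀ A, A ∈ Ω ↔ Om A ∧ ∀ b ∈ oddSub A, z * b * z⁻¹ = b⁻¹) ∧
    ((Subgroup.centralizer {z}).index : ℤ) = 1 + ∑ A ∈ Ω, ((Nat.card (oddSub A) : ℤ) - 1) ∧
    ((Subgroup.centralizer {z}).index : ℤ) = 9 + 3 * ∑ A ∈ Ω, ((Nat.card (oddSub A) : ℤ) - 3) := by
  classical
  have := Fintype.ofFinite G
  have := Fintype.ofFinite (Subgroup G)
  let Ω : Finset (Subgroup G) := Finset.univ.filter fun A => Om A ∧ ∀ b ∈ oddSub A, z * b * z⁻¹ = b⁻¹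
  have hΩ : ∀ A, A ∈ Ω ↔ Om A ∧ ∀ b ∈ oddSub A, z * b * z⁻¹ = b⁻¹ := by simp [Ω]
  let K : Finset G := Finset.univ.filter fun x => ∃ g, x = g * z * g⁻¹
  have hK : ∀ x, x ∈ K ↔ ∃ g, x = g * z * g⁻¹ := by simp [K]
  let Y : Finset G := Finset.univ.filter fun y => Odd (orderOf y) ∧ z * y * z⁻¹ = y⁻¹
  have hY : ∀ y, y ∈ Y ↔ Odd (orderOf y) ∧ z * y * z⁻¹ = y⁻¹ := by simp [Y]
  have hKY : ∀ f : G → ℂ, ∑ x ∈ K, f (z * x) = ∑ y ∈ Y, f y := by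
    intro f
    refine Finset.sum_nbij' (fun x => z * x) (fun x => z * x) ?_ ?_ ?_ ?_ ?_
    · intro x hx
      obtain ⟨g, rfl⟩ := (hK x).mp hx
      have hc := hz.conj g
      refine (hY _).mpr ⟨h.cinv_odd hz hc, ?_⟩
      rw [mul_inv_rev, hc.inv, ← mul_assoc, hz.sq, one_mul]
    · intro y hy
      obtain ⟨⟨k, hk⟩, h1⟩ := (hY y).mp hy
      refine (hK _).mpr ⟨(y ^ (k + 1))⁻¹, ?_⟩
      have h2 : y ^ (k + 1) * y ^ (k + 1) = y := by
        rw [← pow_add]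
        have : k + 1 + (k + 1) = orderOf y + 1 := by omega
        rw [this, pow_succ, pow_orderOf_eq_one, one_mul]
      have h3 : z * y ^ (k + 1) = (y ^ (k + 1))⁻¹ * z := by
        rw [← inv_pow, ← h1, conj_pow]; group
      rw [← h3, inv_inv, mul_assoc, h2]
    · intro x _; simp only [← mul_assoc, hz.sq, one_mul]
    · intro x _; simp only [← mul_assoc, hz.sq, one_mul]
    · intro x _; rfl
  have hdec : ∀ f : G → ℂ, ∑ y ∈ Y, f y = f 1 + ∑ A ∈ Ω, (∑ b : oddSub A, f b - f 1) := by
    intro f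
    have h1Y : (1 : G) ∈ Y := (hY 1).mpr (by simp)
    rw [← Finset.add_sum_erase _ _ h1Y]
    congr 1
    have hmaps : ∀ y ∈ Y.erase 1, Subgroup.centralizer {y} ∈ Ω := by
      intro y hy
      rw [Finset.mem_erase, hY] at hy
      obtain ⟨hy1, hyo, hzy⟩ := hy
      have hA : Om (Subgroup.centralizer {y}) := ⟨y, hy1, hyo, rfl⟩
      have hyA : y ∈ Subgroup.centralizer {y} := mem_cen.mpr rfl
      refine (hΩ _).mpr ⟨hA, hA.inverts h ?_ ?_⟩
      · apply hA.normalizer_of h hyA (odd_two_pow hy1 hyo)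
        rw [hzy]; exact Subgroup.inv_mem _ hyA
      · intro hzA
        rw [mem_cen] at hzA
        rw [hzA, mul_inv_cancel_right] at hzy
        apply odd_two_pow hy1 hyo 1
        rw [pow_one, pow_two]; nth_rewrite 1 [hzy]; simp
    rw [← Finset.sum_fiberwise_of_maps_to hmaps]
    apply Finset.sum_congr rfl
    intro A hA
    obtain ⟨hO, hinv⟩ := (hΩ A).mp hA
    have e : (Y.erase 1).filter (fun y => Subgroup.centralizer {y} = A) =
        (Finset.univ.filter (fun y => y ∈ oddSub A)).erase 1 := by
      ext y
      rw [Finset.mem_filter, Finset.mem_erase, Finset.mem_erase, hY, Finset.mem_filter, mem_oddSub h hO]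
      constructor
      · rintro ⟨⟨h1, h2, h3⟩, rfl⟩
        exact ⟨h1, Finset.mem_univ _, mem_cen.mpr rfl, h2⟩
      · rintro ⟨h1, -, h2, h3⟩
        exact ⟨⟨h1, h3, hinv y ((mem_oddSub h hO).mpr ⟨h2, h3⟩)⟩, (hO.eq h h2 h1 h3).symm⟩
    rw [e, eq_sub_iff_add_eq, Finset.sum_erase_add _ _ (by simp [Subgroup.one_mem])]
    exact Finset.sum_subtype _ (by simp) f
  have hcl := h.sum_class hz K hK
  have hc1 := hKY (fun _ => 1)
  rw [hKY, hdec] at hcl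
  rw [hdec] at hc1
  have hs : ∑ A ∈ Ω, (∑ b : oddSub A, chi ρ b - chi ρ 1) = ∑ A ∈ Ω, ((Nat.card (oddSub A) : ℂ) - 3) := by
    apply Finset.sum_congr rfl
    intro A hA
    obtain ⟨hO, hinv⟩ := (hΩ A).mp hA
    rw [chi_one, h.sum_odd (oddSub A) (fun a ha b hb => hO.ab h a (oddSub_le h hO ha) b (oddSub_le h hO hb))
      (oddSub_odd h hO) _ z hinv]
    intro hb
    have := oddSub_three h hO
    rw [hb, Subgroup.card_bot] at this
    omega
  rw [hs, chi_one] at hcl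
  have hs1 : ∑ A ∈ Ω, (∑ b : oddSub A, (1 : ℂ) - 1) = ∑ A ∈ Ω, ((Nat.card (oddSub A) : ℂ) - 1) := by
    apply Finset.sum_congr rfl
    intro A hA
    simp
  rw [hs1] at hc1
  refine ⟨Ω, hΩ, ?_, ?_⟩
  · rw [← card_class z K hK]
    have h5 : (K.card : ℂ) = 1 + ∑ A ∈ Ω, ((Nat.card (oddSub A) : ℂ) - 1) := by
      rw [← hc1]; simp
    exact_mod_cast h5
  · rw [← card_class z K hK]
    have h5 : (K.card : ℂ) = 9 + 3 * ∑ A ∈ Ω, ((Nat.card (oddSub A) : ℂ) - 3) := by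
      rw [← hcl]; ring
    exact_mod_cast h5

end A9

section A10
variable {G : Type*} [Group G] [Finite G] {ρ : G →* GL (Fin 3) ℂ}

lemma even_perm_comm {n : ℕ} (hn : n ≤ 3) : ∀ π σ : Equiv.Perm (Fin n), Equiv.Perm.sign π = 1 →
    Equiv.Perm.sign σ = 1 → π * σ = σ * π := by
  interval_cases n <;> decide

lemma perf_index (hp : commutator G = ⊤) (H : Subgroup G) (hH : H.index ≤ 3) : H = ⊤ := by
  have e : G ⧸ H ≃ Fin H.index := Finite.equivFin (G ⧸ H)
  let φ : G →* Equiv.Perm (Fin H.index) :=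
    e.permCongrHom.toMonoidHom.comp (MulAction.toPermHom G (G ⧸ H))
  have hs : ∀ g, Equiv.Perm.sign (φ g) = 1 := fun g => perf_hom hp (Equiv.Perm.sign.comp φ) g
  have hc : commutator G ≤ φ.ker := by
    rw [commutator_def, Subgroup.commutator_le]
    intro a _ b _
    rw [MonoidHom.mem_ker, map_commutatorElement, commutatorElement_eq_one_iff_mul_comm]
    exact even_perm_comm hH _ _ (hs a) (hs b)
  rw [hp] at hc
  rw [eq_top_iff]
  intro g _
  have h1 : φ g = 1 := hc (Subgroup.mem_top g)
  have h2 : MulAction.toPermHom G (G ⧸ H) g = 1 := by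
    apply e.permCongrHom.injective
    rw [map_one]; exact h1
  have h3 := congrArg (fun p : Equiv.Perm (G ⧸ H) => p ((1 : G) : G ⧸ H)) h2
  have h4 : ((g * 1 : G) : G ⧸ H) = ((1 : G) : G ⧸ H) := h3
  rw [mul_one, eq_comm, QuotientGroup.eq] at h4
  simpa using h4

def nonTwo (A : Subgroup G) : Set G := {a | a ∈ A ∧ ∀ k : ℕ, a ^ (2 ^ k) ≠ 1}

def UU (A : Subgroup G) : Set G := {x | ∃ g : G, ∃ a ∈ nonTwo A, x = g * a * g⁻¹}

lemma nonTwo_card (h : PCtx G ρ) {A : Subgroup G} (hA : Om A) :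
    2 * Nat.card A ≤ 3 * Nat.card (nonTwo A) := by
  let T : Set G := {a | a ∈ A ∧ ∃ k : ℕ, a ^ (2 ^ k) = 1}
  have hab := hA.ab h
  have h1 : Nat.card T * Nat.card (oddSub A) ≤ Nat.card A := by
    rw [← Nat.card_prod]
    let f : T × oddSub A → A := fun p => ⟨p.1 * p.2, A.mul_mem p.1.2.1 (oddSub_le h hA p.2.2)⟩
    refine Nat.card_le_card_of_injective f ?_
    rintro ⟨⟨t, ht, k, hk⟩, ⟨b, hb⟩⟩ ⟨⟨t', ht', k', hk'⟩, ⟨b', hb'⟩⟩ hf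
    have hf' : t * b = t' * b' := congrArg Subtype.val hf
    have e : t'⁻¹ * t = b' * b⁻¹ := by
      rw [inv_mul_eq_iff_eq_mul, ← mul_assoc, ← hf']; group
    have hm := (mem_oddSub h hA).mp ((oddSub A).mul_mem hb' ((oddSub A).inv_mem hb))
    have h1 : b' * b⁻¹ = 1 := by
      by_contra hne
      apply odd_two_pow hne hm.2 (k + k')
      rw [← e]
      have hcm : Commute t'⁻¹ t := hab _ (A.inv_mem ht') _ ht
      rw [hcm.mul_pow, pow_add, pow_mul t, hk, one_pow, mul_one, mul_comm, pow_mul, inv_pow, hk']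
      simp
    have hbb : b = b' := (mul_inv_eq_one.mp h1).symm
    subst hbb
    have htt : t = t' := mul_right_cancel hf'
    subst htt
    rfl
  have h2 := oddSub_three h hA
  have h3 : Nat.card T + Nat.card (nonTwo A) = Nat.card A := by
    have hu : T ∪ nonTwo A = (A : Set G) := by
      ext x
      simp only [T, nonTwo, Set.mem_union, Set.mem_setOf_eq, SetLike.mem_coe]
      constructor
      · rintro (hx | hx) <;> exact hx.1
      · intro hx
        by_cases hk : ∃ k : ℕ, x ^ (2 ^ k) = 1
        · exact Or.inl ⟨hx, hk⟩
        · push Not at hk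
          exact Or.inr ⟨hx, hk⟩
    have hd : Disjoint T (nonTwo A) := by
      rw [Set.disjoint_left]
      rintro x ⟨_, k, hk⟩ ⟨_, hk'⟩
      exact hk' k hk
    have := Set.ncard_union_eq hd (Set.toFinite _) (Set.toFinite _)
    rw [hu] at this
    exact this.symm
  nlinarith

lemma UU_card (h : PCtx G ρ) {A : Subgroup G} (hA : Om A) :
    Nat.card G ≤ 3 * Nat.card (UU A) := by
  have h1 : Nat.card G * Nat.card (nonTwo A) ≤
      Nat.card (Subgroup.normalizer (A : Set G)) * Nat.card (UU A) := by
    rw [← Nat.card_prod, ← Nat.card_prod]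
    have hch : ∀ u : UU A, ∃ g : G, g⁻¹ * u * g ∈ A := by
      rintro ⟨u, g, a, ha, rfl⟩
      refine ⟨g, ?_⟩
      have : g⁻¹ * (g * a * g⁻¹) * g = a := by group
      rw [this]; exact ha.1
    choose r hr using hch
    let F : G × nonTwo A → UU A := fun p => ⟨p.1 * p.2 * p.1⁻¹, p.1, p.2, p.2.2, rfl⟩
    have hN : ∀ p : G × nonTwo A, (r (F p))⁻¹ * p.1 ∈ Subgroup.normalizer (A : Set G) := by
      intro p
      apply hA.normalizer_of h p.2.2.1 p.2.2.2
      have := hr (F p)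
      have e : (r (F p))⁻¹ * p.1 * p.2 * ((r (F p))⁻¹ * p.1)⁻¹ = (r (F p))⁻¹ * (F p : G) * r (F p) := by
        simp only [F]; group
      rw [e]; exact this
    refine Nat.card_le_card_of_injective
      (fun p => ((⟨_, hN p⟩ : Subgroup.normalizer (A : Set G)), F p)) ?_
    rintro p q hpq
    have e2 : F p = F q := congrArg Prod.snd hpq
    have e1 : (r (F p))⁻¹ * p.1 = (r (F q))⁻¹ * q.1 := congrArg (fun t => (t.1 : G)) hpq
    rw [e2] at e1
    have e3 : p.1 = q.1 := mul_left_cancel e1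
    have e4 : p.1 * p.2 * p.1⁻¹ = q.1 * q.2 * q.1⁻¹ := congrArg Subtype.val e2
    rw [e3] at e4
    exact Prod.ext e3 (Subtype.ext (mul_left_cancel (mul_right_cancel e4)))
  have h2 := hA.norm_card h
  have h3 := nonTwo_card h hA
  have h4 : 0 < Nat.card A := Nat.card_pos
  have h5 : 0 < Nat.card (nonTwo A) := by omega
  have h6 : Nat.card (Subgroup.normalizer (A : Set G)) * Nat.card (UU A) ≤
    (3 * Nat.card (nonTwo A)) * Nat.card (UU A) := Nat.mul_le_mul_right _ (h2.trans h3)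
  apply Nat.le_of_mul_le_mul_right _ h5
  calc _ ≤ _ := h1
    _ ≤ _ := h6
    _ = _ := by ring

lemma UU_disj (h : PCtx G ρ) {A A' : Subgroup G} (hA : Om A) (hA' : Om A')
    (hc : ∀ g, cj g A ≠ A') : Disjoint (UU A) (UU A') := by
  rw [Set.disjoint_left]
  rintro _ ⟨g, a, ha, rfl⟩ ⟨g', a', ha', e⟩
  apply hc (g'⁻¹ * g)
  apply Om.eq_of h (hA.cj _) hA' (x := a') _ ha'.1 ha'.2
  rw [mem_cj]
  have : (g'⁻¹ * g)⁻¹ * a' * (g'⁻¹ * g) = g⁻¹ * (g' * a' * g'⁻¹) * g := by group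
  rw [this, ← e]
  have : g⁻¹ * (g * a * g⁻¹) * g = a := by group
  rw [this]; exact ha.1

lemma three_classes (h : PCtx G ρ) {A1 A2 A3 : Subgroup G} (h1 : Om A1) (h2 : Om A2) (h3 : Om A3)
    (h12 : ∀ g, cj g A1 ≠ A2) (h13 : ∀ g, cj g A1 ≠ A3) (h23 : ∀ g, cj g A2 ≠ A3) : False := by
  have d12 := UU_disj h h1 h2 h12
  have d13 := UU_disj h h1 h3 h13
  have d23 := UU_disj h h2 h3 h23
  have c1 := UU_card h h1
  have c2 := UU_card h h2
  have c3 := UU_card h h3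
  have one : ∀ A : Subgroup G, (1 : G) ∉ UU A := by
    rintro A ⟨g, a, ha, e⟩
    apply ha.2 0
    have : a = 1 := by simpa using e.symm
    simp [this]
  have e1 := Set.ncard_union_eq d12 (Set.toFinite _) (Set.toFinite _)
  have e2 := Set.ncard_union_eq (d13.union_left d23) (Set.toFinite _) (Set.toFinite _)
  have hlt : ((UU A1 ∪ UU A2) ∪ UU A3).ncard < (Set.univ : Set G).ncard := by
    apply Set.ncard_lt_ncard _ (Set.toFinite _)
    rw [Set.ssubset_univ_iff]
    intro hu
    have : (1 : G) ∈ (UU A1 ∪ UU A2) ∪ UU A3 := by rw [hu]; trivial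
    rcases this with (hh | hh) | hh <;> exact one _ hh
  rw [Set.ncard_univ] at hlt
  rw [Nat.card_coe_set_eq] at c1 c2 c3
  omega

lemma cinv_index_odd {z : G} (hz : CInv z) : Odd (Subgroup.centralizer {z}).index := by
  obtain ⟨-, -, S, hS, hc⟩ := hz
  have hle : (S : Subgroup G) ≤ Subgroup.centralizer {z} := fun s hs => mem_cen.mpr (hc s hs)
  have h1 := Subgroup.index_dvd_of_le hle
  have h2 := S.not_dvd_index
  rw [← Nat.not_even_iff_odd, even_iff_two_dvd]
  exact fun hh => h2 (hh.trans h1)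

theorem PCtx.absurd (h : PCtx G ρ) : False := by
  classical
  obtain ⟨z, hz⟩ := h.exists_cinv
  obtain ⟨Ω, hΩ, k1, k2⟩ := h.count hz
  set k := (Subgroup.centralizer {z}).index with hk
  have hkodd : Odd k := cinv_index_odd hz
  have hkG : k ∣ Nat.card G := Subgroup.index_dvd_card _
  have hb3 : ∀ A ∈ Ω, 3 ≤ Nat.card (oddSub A) := fun A hA => oddSub_three h ((hΩ A).mp hA).1
  have hbo : ∀ A ∈ Ω, Odd (Nat.card (oddSub A)) := fun A hA => oddSub_odd h ((hΩ A).mp hA).1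
  have hS : ∑ A ∈ Ω, ((Nat.card (oddSub A) : ℤ) - 1) = ∑ A ∈ Ω, ((Nat.card (oddSub A) : ℤ) - 3) + 2 * Ω.card := by
    have : ∀ A ∈ Ω, (Nat.card (oddSub A) : ℤ) - 1 = ((Nat.card (oddSub A) : ℤ) - 3) + 2 := by
      intro A _; ring
    rw [Finset.sum_congr rfl this, Finset.sum_add_distrib]
    simp [mul_comm]
  have hcj : ∀ (A : Subgroup G) (g : G), Om A → Nat.card (oddSub (cj g A)) = Nat.card (oddSub A) := by
    intro A g hA
    rw [oddSub_cj h hA, card_cj]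
  obtain ⟨A1, hA1, hb1⟩ : ∃ A ∈ Ω, Nat.card (oddSub A) = 3 := by
    by_contra hno
    push Not at hno
    have : ∑ A ∈ Ω, (2 : ℤ) ≤ ∑ A ∈ Ω, ((Nat.card (oddSub A) : ℤ) - 3) := by
      apply Finset.sum_le_sum
      intro A hA
      have h1 := hb3 A hA
      obtain ⟨j, hj⟩ := hbo A hA
      have h2 := hno A hA
      omega
    rw [Finset.sum_const] at this
    simp only [nsmul_eq_mul] at this
    linarith
  have hO1 := ((hΩ A1).mp hA1).1
  have h9 : ¬ 9 ∣ Nat.card G := by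
    intro h9
    have h3A : 3 ∣ Nat.card A1 := by
      rw [← hb1]; exact Subgroup.card_dvd_of_le (oddSub_le h hO1)
    have := hO1.sylow h Nat.prime_three (by norm_num) h3A (k := 2) (by norm_num; exact h9)
    rw [hb1] at this
    norm_num at this
  obtain ⟨A2, hA2, hb2⟩ : ∃ A ∈ Ω, Nat.card (oddSub A) ≠ 3 := by
    by_contra hno
    push Not at hno
    have h0 : ∑ A ∈ Ω, ((Nat.card (oddSub A) : ℤ) - 3) = 0 := by
      apply Finset.sum_eq_zero
      intro A hA
      rw [hno A hA]; norm_num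
    rw [h0] at k2
    have : k = 9 := by omega
    rw [this] at hkG
    exact h9 hkG
  have hO2 := ((hΩ A2).mp hA2).1
  set b := Nat.card (oddSub A2) with hb
  have hb5 : 5 ≤ b := by
    have h1 := hb3 A2 hA2
    obtain ⟨j, hj⟩ := hbo A2 hA2
    omega
  have hclass : ∀ A, Om A → (∃ g, cj g A1 = A) ∨ (∃ g, cj g A2 = A) := by
    intro A hA
    by_contra hno
    push Not at hno
    refine three_classes h hO1 hO2 hA ?_ hno.1 hno.2
    intro g hg
    apply hb2
    rw [hb, ← hg, hcj A1 g hO1, hb1]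
  have hk3b : k ∣ 3 * b := by
    rw [Nat.dvd_iff_prime_pow_dvd_dvd]
    intro p j hp hj
    rcases Nat.eq_zero_or_pos j with rfl | hjp
    · simp
    have hpk : p ∣ k := (dvd_pow_self p hjp.ne').trans hj
    have hp2 : p ≠ 2 := by
      rintro rfl
      exact (Nat.not_even_iff_odd.mpr hkodd) (even_iff_two_dvd.mpr hpk)
    obtain ⟨A, hA, hpA⟩ := h.exists_om hp hp2 (hpk.trans hkG)
    have h1 := hA.sylow h hp hp2 hpA (hj.trans hkG)
    rcases hclass A hA with ⟨g, rfl⟩ | ⟨g, rfl⟩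
    · rw [hcj A1 g hO1, hb1] at h1
      exact h1.mul_right b
    · rw [hcj A2 g hO2] at h1
      exact h1.mul_left 3
  have hkle : k ≤ 3 * b := Nat.le_of_dvd (by omega) hk3b
  have huniq : ∀ A ∈ Ω, Nat.card (oddSub A) ≠ 3 → A = A2 := by
    intro A hA hne
    by_contra hAA
    have hbA : Nat.card (oddSub A) = b := by
      rcases hclass A ((hΩ A).mp hA).1 with ⟨g, rfl⟩ | ⟨g, rfl⟩
      · exact (hne (by rw [hcj A1 g hO1, hb1])).elim
      · rw [hcj A2 g hO2]
    have h1 : ∑ B ∈ ({A, A2} : Finset (Subgroup G)), ((Nat.card (oddSub B) : ℤ) - 3) ≤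
        ∑ B ∈ Ω, ((Nat.card (oddSub B) : ℤ) - 3) := by
      apply Finset.sum_le_sum_of_subset_of_nonneg
      · intro B hB
        rw [Finset.mem_insert, Finset.mem_singleton] at hB
        rcases hB with rfl | rfl <;> assumption
      · intro B hB _
        have := hb3 B hB
        omega
    rw [Finset.sum_pair hAA, hbA, ← hb] at h1
    omega
  have hsum : ∑ A ∈ Ω, ((Nat.card (oddSub A) : ℤ) - 3) = b - 3 := by
    rw [Finset.sum_eq_single A2]
    · intro A hA hne
      have : Nat.card (oddSub A) = 3 := by
        by_contra hh
        exact hne (huniq A hA hh)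
      rw [this]; norm_num
    · intro hh; exact (hh hA2).elim
  have hk' : k = 3 * b := by rw [hsum] at k2; omega
  have hCN : Subgroup.centralizer {z} ≤ Subgroup.normalizer (A2 : Set G) := by
    intro c hc
    rw [mem_cen] at hc
    rw [← cj_self_iff]
    apply huniq
    · rw [hΩ]
      refine ⟨hO2.cj c, ?_⟩
      intro x hx
      rw [oddSub_cj h hO2, mem_cj] at hx
      have h1 := ((hΩ A2).mp hA2).2 _ hx
      have hc' : z * c = c * z := hc.symm
      have hci : z * c⁻¹ = c⁻¹ * z := (Commute.inv_right (show Commute z c from hc'))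
      calc z * x * z⁻¹ = z * c * (c⁻¹ * x * c) * (z * c)⁻¹ := by group
        _ = c * (z * (c⁻¹ * x * c) * z⁻¹) * c⁻¹ := by rw [hc']; group
        _ = x⁻¹ := by rw [h1]; group
    · rw [hcj A2 c hO2]; exact hb2
  set N := Subgroup.normalizer (A2 : Set G) with hN
  have hi1 : N.index ∣ 3 * b := by rw [← hk']; exact Subgroup.index_dvd_of_le hCN
  have hi2 : N.index ∣ A2.index := Subgroup.index_dvd_of_le Subgroup.le_normalizer
  have hcop : Nat.Coprime A2.index b := by
    apply Nat.Coprime.symm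
    apply Nat.coprime_of_dvd
    intro p hp hpb hpi
    have hp2 : p ≠ 2 := by
      rintro rfl
      exact (Nat.not_even_iff_odd.mpr (hbo A2 hA2)) (even_iff_two_dvd.mpr hpb)
    have hbA : b ∣ Nat.card A2 := Subgroup.card_dvd_of_le (oddSub_le h hO2)
    have hpA : p ∣ Nat.card A2 := hpb.trans hbA
    have hG : Nat.card A2 * A2.index = Nat.card G := Subgroup.card_mul_index A2
    have key : ∀ j : ℕ, p ^ (j + 1) ∣ Nat.card G := by
      intro j
      induction j with
      | zero => simpa using hpA.trans (Subgroup.card_subgroup_dvd_card A2)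
      | succ j ih =>
        have := (hO2.sylow h hp hp2 hpA ih).trans hbA
        rw [← hG, pow_succ]
        exact mul_dvd_mul this hpi
    have h1 := Nat.le_of_dvd Nat.card_pos (key (Nat.card G))
    have h2 : Nat.card G < p ^ Nat.card G := Nat.lt_pow_self hp.one_lt
    have h3 : p ^ Nat.card G ≤ p ^ (Nat.card G + 1) := Nat.pow_le_pow_right hp.pos (Nat.le_succ _)
    omega
  have hi3 : N.index ∣ 3 := (Nat.Coprime.coprime_dvd_left hi2 hcop).dvd_of_dvd_mul_right hi1
  have hNtop : N = ⊤ := perf_index h.perf N (Nat.le_of_dvd (by norm_num) hi3)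
  have hcard := hO2.norm_card h
  rw [← hN, hNtop, Subgroup.card_top, ← Subgroup.card_mul_index A2, mul_comm] at hcard
  have hi : A2.index ≤ 2 := Nat.le_of_mul_le_mul_right hcard Nat.card_pos
  have hAtop : A2 = ⊤ := perf_index h.perf A2 (by omega)
  have hab := hO2.ab h
  have htriv := perf_abelian h.perf (fun a b => hab a (hAtop ▸ Subgroup.mem_top a) b (hAtop ▸ Subgroup.mem_top b))
  exact hz.ne (htriv z)

end A10

theorem stmt_8 (G : Type*) [Group G] [Finite G] (h : MinFaithful G 3) :
    commutator G ≠ ⊤ := by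
  intro hperf
  obtain ⟨h3, hH⟩ := h
  have hne : {n : ℕ | ∃ ρ : G →* GL (Fin n) ℂ, Function.Injective ρ}.Nonempty := by
    apply Nat.nonempty_of_pos_sInf
    change 0 < rdim G
    omega
  have hmem := Nat.sInf_mem hne
  change rdim G ∈ _ at hmem
  rw [h3] at hmem
  obtain ⟨ρ, hρ⟩ := hmem
  have hP : PCtx G ρ := by
    refine ⟨hρ, hperf, ?_, ?_⟩
    · intro H hHt
      have hlt := hH H hHt
      have hne' : {n : ℕ | ∃ ρ : H →* GL (Fin n) ℂ, Function.Injective ρ}.Nonempty :=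
        ⟨3, ρ.comp H.subtype, hρ.comp H.subtype_injective⟩
      obtain ⟨f, hf⟩ := Nat.sInf_mem hne'
      exact ⟨rdim H, by omega, f, hf⟩
    · intro n hn f hf
      have : rdim G ≤ n := Nat.sInf_le ⟨f, hf⟩
      omega
  exact hP.absurd
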